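/- arXiv:2605.01375 — 2 statements merged into one kernel-verified Lean document; each statement's English description precedes it below -/
import Mathlib

section
/- (Theorem 1) Let ρ_AB be a density matrix on ℂ^{d_A} ⊗ ℂ^{d_B} with d_A, d_B ≥ 2, reduced-state purities P_A = Tr[ρ_A²], P_B = Tr[ρ_B²], global purity P_AB = Tr[ρ_AB²], and d_AB = d_A d_B. Then the squashed entanglement satisfies E_sq(ρ_AB) ≥ max{ max{L(P_A), L(P_B)} − U(P_AB, d_AB), 0 }. -/
open scoped Kronecker ComplexOrder

/-- Von Neumann entropy (natural logarithm) of a matrix, via its eigenvalues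
(`0` if the matrix is not Hermitian; `Real.log 0 = 0` handles zero eigenvalues). -/
noncomputable def vN {n : Type*} [Fintype n] [DecidableEq n] (ρ : Matrix n n ℂ) : ℝ :=
  if h : ρ.IsHermitian then -∑ i, h.eigenvalues i * Real.log (h.eigenvalues i) else 0

/-- Partial trace over the second tensor factor. -/
noncomputable def ptraceB {A B : Type*} [Fintype B] (ρ : Matrix (A × B) (A × B) ℂ) :
    Matrix A A ℂ := Matrix.of fun a a' => ∑ b, ρ (a, b) (a', b)

/-- Partial trace over the first tensor factor. -/
noncomputable def ptraceA {A B : Type*} [Fintype A] (ρ : Matrix (A × B) (A × B) ℂ) :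
    Matrix B B ℂ := Matrix.of fun b b' => ∑ a, ρ (a, b) (a, b')

/-- Partial trace over the third factor of a tripartite system `A × B × C`. -/
noncomputable def ptraceC3 {A B C : Type*} [Fintype C] (ρ : Matrix (A × B × C) (A × B × C) ℂ) :
    Matrix (A × B) (A × B) ℂ := Matrix.of fun x y => ∑ c, ρ (x.1, x.2, c) (y.1, y.2, c)

/-- Partial trace over the second factor of a tripartite system `A × B × C`. -/
noncomputable def ptraceB3 {A B C : Type*} [Fintype B] (ρ : Matrix (A × B × C) (A × B × C) ℂ) :
    Matrix (A × C) (A × C) ℂ := Matrix.of fun x y => ∑ b, ρ (x.1, b, x.2) (y.1, b, y.2)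

/-- Conditional mutual information `I(A:B|C) = S(ρ_AC) + S(ρ_BC) − S(ρ_ABC) − S(ρ_C)`. -/
noncomputable def condMutualInfo {A B C : Type*} [Fintype A] [DecidableEq A] [Fintype B]
    [DecidableEq B] [Fintype C] [DecidableEq C]
    (ρ : Matrix (A × B × C) (A × B × C) ℂ) : ℝ :=
  vN (ptraceB3 ρ) + vN (ptraceA ρ) - vN ρ - vN (ptraceA (ptraceA ρ))

/-- Squashed entanglement: `(1/2) inf I(A:B|C)` over all finite-dimensional extensions
`ρ_ABC` (density matrices with `Tr_C ρ_ABC = ρ_AB`). -/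
noncomputable def Esq {A B : Type*} [Fintype A] [DecidableEq A] [Fintype B] [DecidableEq B]
    (ρAB : Matrix (A × B) (A × B) ℂ) : ℝ :=
  sInf { x : ℝ | ∃ (dC : ℕ), 1 ≤ dC ∧
    ∃ ρ : Matrix (A × B × Fin dC) (A × B × Fin dC) ℂ,
      ρ.PosSemidef ∧ ρ.trace = 1 ∧ ptraceC3 ρ = ρAB ∧ x = (1 / 2) * condMutualInfo ρ }

/-- Lower bound `L(P)` on the entropy at fixed purity `P`, where `k` is the integer
with `1/k ≤ P ≤ 1/(k−1)`: `L(P) = −[(1 − λ_k) ln λ₁ + λ_k ln λ_k]` with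
`λ_k = 1/k − √((1 − 1/k)(P − 1/k))` and `λ₁ = (1 − λ_k)/(k − 1)`. -/
noncomputable def Lent (P : ℝ) (k : ℕ) : ℝ :=
  let lamk : ℝ := 1 / (k : ℝ) - Real.sqrt ((1 - 1 / (k : ℝ)) * (P - 1 / (k : ℝ)))
  let lam1 : ℝ := (1 - lamk) / ((k : ℝ) - 1);
  -((1 - lamk) * Real.log lam1 + lamk * Real.log lamk)

/-- Upper bound `U(P,d)` on the entropy at fixed purity `P` in dimension `d`:
`U(P,d) = −[(1 − λ) ln((1 − λ)/(d − 1)) + λ ln λ]` with `λ = 1/d + √((1 − 1/d)(P − 1/d))`. -/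
noncomputable def Uent (P : ℝ) (d : ℕ) : ℝ :=
  let lam : ℝ := 1 / (d : ℝ) + Real.sqrt ((1 - 1 / (d : ℝ)) * (P - 1 / (d : ℝ)));
  -((1 - lam) * Real.log ((1 - lam) / ((d : ℝ) - 1)) + lam * Real.log lam)

/-- Comparing the Stieltjes transforms of two finite measures of the same mass compares their
logarithmic moments. -/
theorem neg_sum_mul_log_le_of_sum_div_add_le {ι κ : Type*} [Fintype ι] [Fintype κ]
    (a x : ι → ℝ) (b y : κ → ℝ)
    (hx : ∀ i, 0 < x i ∨ (a i = 0 ∧ x i = 0)) (hy : ∀ j, 0 < y j ∨ (b j = 0 ∧ y j = 0))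
    (hab : ∑ i, a i = ∑ j, b j)
    (h : ∀ t : ℝ, 0 < t → ∑ i, a i / (x i + t) ≤ ∑ j, b j / (y j + t)) :
    -∑ i, a i * Real.log (x i) ≤ -∑ j, b j * Real.log (y j) := by
  have deriv_term : ∀ {α z T : ℝ}, (0 < z ∨ (α = 0 ∧ z = 0)) → 0 ≤ T →
      HasDerivAt (fun T => α * (Real.log (z + T) - Real.log z)) (α / (z + T)) T := by
    intro α z T hz hT
    rcases hz with hz | ⟨rfl, rfl⟩
    · have h1 : HasDerivAt (fun T => z + T) 1 T := (hasDerivAt_id T).const_add z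
      have h2 := ((h1.log (by positivity)).sub_const (Real.log z)).const_mul α
      exact h2.congr_deriv (mul_one_div α (z + T))
    · simpa using hasDerivAt_const T (0 : ℝ)
  have lim_term : ∀ {α z : ℝ}, (0 < z ∨ (α = 0 ∧ z = 0)) →
      Filter.Tendsto (fun T : ℝ => α * (Real.log (z + T) - Real.log z) - α * Real.log T)
        Filter.atTop (nhds (-(α * Real.log z))) := by
    intro α z hz
    rcases hz with hz | ⟨rfl, rfl⟩
    · have h1 : Filter.Tendsto (fun T : ℝ => z / T + 1) Filter.atTop (nhds 1) := by
        simpa using (Filter.Tendsto.const_div_atTop Filter.tendsto_id z).add_const 1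
      have h2 : Filter.Tendsto (fun T : ℝ => α * Real.log (z / T + 1) - α * Real.log z)
          Filter.atTop (nhds (-(α * Real.log z))) := by
        simpa using ((h1.log one_ne_zero).const_mul α).sub_const (α * Real.log z)
      refine h2.congr' ?_
      filter_upwards [Filter.eventually_gt_atTop 0] with T hT
      have h3 : z / T + 1 = (z + T) / T := by field_simp
      rw [h3, Real.log_div (by positivity) hT.ne']
      ring
    · simp
  let G : ℝ → ℝ := fun T => ∑ j, b j * (Real.log (y j + T) - Real.log (y j)) -
    ∑ i, a i * (Real.log (x i + T) - Real.log (x i))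
  have hG : ∀ T, 0 ≤ T →
      HasDerivAt G (∑ j, b j / (y j + T) - ∑ i, a i / (x i + T)) T := fun T hT =>
    (HasDerivAt.fun_sum fun j _ => deriv_term (hy j) hT).sub
      (HasDerivAt.fun_sum fun i _ => deriv_term (hx i) hT)
  have hmono : MonotoneOn G (Set.Ici 0) := by
    refine monotoneOn_of_deriv_nonneg (convex_Ici 0)
      (fun T hT => (hG T hT).continuousAt.continuousWithinAt) ?_ ?_
    · intro T hT
      rw [interior_Ici] at hT
      exact (hG T (le_of_lt hT)).differentiableAt.differentiableWithinAt
    · intro T hT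
      rw [interior_Ici] at hT
      rw [(hG T (le_of_lt hT)).deriv]
      exact sub_nonneg.2 (h T hT)
  have hnonneg : ∀ T, 0 ≤ T → 0 ≤ G T := by
    intro T hT
    have := hmono (Set.mem_Ici.2 le_rfl) (Set.mem_Ici.2 hT) hT
    simpa [G] using this
  have hlim : Filter.Tendsto G Filter.atTop
      (nhds (∑ j, -(b j * Real.log (y j)) - ∑ i, -(a i * Real.log (x i)))) := by
    have h1 := (tendsto_finsetSum Finset.univ fun j _ => lim_term (hy j)).sub
      (tendsto_finsetSum Finset.univ fun i _ => lim_term (hx i))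
    refine h1.congr fun T => ?_
    simp only [Finset.sum_sub_distrib, ← Finset.sum_mul, hab, G]
    ring
  have := ge_of_tendsto hlim
    ((Filter.eventually_ge_atTop 0).mono fun T hT => hnonneg T hT)
  simp only [Finset.sum_neg_distrib] at this
  linarith

/-- Shannon entropy at fixed purity is at most that of a vector with one large entry and all
others equal. -/
theorem entropy_le_Uent {ι : Type*} [Fintype ι] (d : ℕ) (hd : 2 ≤ d) (hcard : Fintype.card ι = d)
    (p : ι → ℝ) (hp : ∀ i, 0 ≤ p i) (hsum : ∑ i, p i = 1) (P : ℝ) (hP : ∑ i, p i ^ 2 = P) :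
    -∑ i, p i * Real.log (p i) ≤ Uent P d := by
  classical
  have hd' : (2 : ℝ) ≤ d := by exact_mod_cast hd
  have hd0 : (0 : ℝ) < d := by linarith
  have hd1 : (0 : ℝ) < (d : ℝ) - 1 := by linarith
  have hp1 : ∀ i, p i ≤ 1 := fun i => hsum ▸
    Finset.single_le_sum (fun j _ => hp j) (Finset.mem_univ i)
  have hPle : P ≤ 1 := by
    rw [← hP, ← hsum]
    exact Finset.sum_le_sum fun i _ => by nlinarith [hp i, hp1 i]
  have hPge : 1 ≤ d * P := by
    have := sq_sum_le_card_mul_sum_sq (s := Finset.univ) (f := p)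
    simpa [hsum, hP, hcard] using this
  have hradnn : 0 ≤ (1 - 1 / (d : ℝ)) * (P - 1 / (d : ℝ)) := by
    apply mul_nonneg
    · rw [sub_nonneg, div_le_one hd0]; linarith
    · rw [sub_nonneg, div_le_iff₀ hd0]; linarith
  set r := Real.sqrt ((1 - 1 / (d : ℝ)) * (P - 1 / (d : ℝ))) with hr
  have hr0 : 0 ≤ r := Real.sqrt_nonneg _
  have hrsq : (d * r) ^ 2 = (d - 1) * (d * P - 1) := by
    rw [mul_pow, hr, Real.sq_sqrt hradnn]; field_simp
  set lam := 1 / (d : ℝ) + r with hlam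
  have hlamd : d * lam = 1 + d * r := by rw [hlam]; field_simp
  set mu := (1 - lam) / ((d : ℝ) - 1) with hmu
  have hmul : (d - 1) * mu + lam = 1 := by rw [hmu]; field_simp; ring
  have hmuP : (d - 1) * mu ^ 2 + lam ^ 2 = P := by
    have h1 : (d * lam - 1) ^ 2 = (d - 1) * (d * P - 1) := by rw [hlamd, ← hrsq]; ring
    have h2 : (d - 1) * mu = 1 - lam := by linarith
    have h3 : ((d : ℝ) - 1) * d * ((d - 1) * mu ^ 2 + lam ^ 2) = (d - 1) * d * P := by
      have : ((d : ℝ) - 1) * d * ((d - 1) * mu ^ 2 + lam ^ 2)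
        = d * (((d - 1) * mu) ^ 2 + (d - 1) * lam ^ 2) := by ring
      rw [this, h2]; nlinarith
    exact mul_left_cancel₀ (by positivity) h3
  have hlam0 : 0 < lam := by rw [hlam]; positivity
  have hlam1 : lam ≤ 1 := by
    have : d * r ≤ d - 1 := by
      apply abs_le_of_sq_le_sq' _ hd1.le |>.2
      rw [hrsq, sq]
      apply mul_le_mul_of_nonneg_left _ hd1.le
      nlinarith
    nlinarith
  have hmu0 : 0 ≤ mu := div_nonneg (by linarith) hd1.le
  have hple : ∀ i, p i ≤ lam := by
    intro i
    have h1 := sq_sum_le_card_mul_sum_sq (s := Finset.univ.erase i) (f := p)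
    have h2 : ∑ j ∈ Finset.univ.erase i, p j = 1 - p i := by
      rw [← hsum, ← Finset.add_sum_erase _ _ (Finset.mem_univ i)]; ring
    have h3 : ∑ j ∈ Finset.univ.erase i, p j ^ 2 = P - p i ^ 2 := by
      rw [← hP, ← Finset.add_sum_erase _ _ (Finset.mem_univ i)]; ring
    rw [h2, h3, Finset.card_erase_of_mem (Finset.mem_univ i), Finset.card_univ, hcard,
      Nat.cast_sub (by omega)] at h1
    push_cast at h1
    have h4 : d * p i - 1 ≤ d * r := by
      apply abs_le_of_sq_le_sq' _ (by positivity) |>.2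
      rw [hrsq]; nlinarith
    exact le_of_mul_le_mul_left (by linarith) hd0
  have hU : Uent P d = -∑ j : Bool, (cond j lam (1 - lam)) * Real.log (cond j lam mu) := by
    simp only [Uent, Fintype.sum_bool, cond_true, cond_false, ← hr, ← hlam, ← hmu]
    ring
  rw [hU]
  refine neg_sum_mul_log_le_of_sum_div_add_le p p _ _ ?_ ?_ ?_ ?_
  · intro i
    rcases (hp i).lt_or_eq with h | h
    · exact Or.inl h
    · exact Or.inr ⟨h.symm, h.symm⟩
  · rintro (_ | _)
    · rcases hmu0.lt_or_eq with h | h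
      · exact Or.inl h
      · refine Or.inr ⟨?_, h.symm⟩
        simp only [cond_false]
        rw [← h] at hmul; linarith
    · exact Or.inl hlam0
  · simp [hsum]
  · intro t ht
    have hpt : ∀ i, 0 < p i + t := fun i => by linarith [hp i]
    have hmt : 0 < mu + t := by linarith
    have hlt : 0 < lam + t := by linarith
    set B := -(2 * mu + lam) - t with hB
    set C := mu ^ 2 + 2 * mu * lam - t * B with hC
    set D := (mu + t) ^ 2 * (lam + t) with hD
    have hD0 : 0 < D := by positivity
    have hpoint : ∀ i, p i / (p i + t) ≤ 1 - t * ((p i ^ 2 + B * p i + C) / D) := by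
      intro i
      have h1 : (p i ^ 2 + B * p i + C) / D ≤ 1 / (p i + t) := by
        rw [div_le_div_iff₀ hD0 (hpt i)]
        have h2 : (p i - mu) ^ 2 * (lam - p i) ≥ 0 :=
          mul_nonneg (sq_nonneg _) (by linarith [hple i])
        have : (p i ^ 2 + B * p i + C) * (p i + t) = D - (p i - mu) ^ 2 * (lam - p i) := by
          rw [hC, hB, hD]; ring
        linarith
      have h3 : p i / (p i + t) = 1 - t * (1 / (p i + t)) := by
        have := (hpt i).ne'
        field_simp; ring
      rw [h3]
      have := mul_le_mul_of_nonneg_left h1 ht.le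
      linarith
    refine (Finset.sum_le_sum fun i _ => hpoint i).trans (le_of_eq ?_)
    have h4 : ∑ i, (1 - t * ((p i ^ 2 + B * p i + C) / D)) = d - t * ((P + B + C * d) / D) := by
      rw [Finset.sum_sub_distrib, ← Finset.mul_sum, ← Finset.sum_div, Finset.sum_add_distrib,
        Finset.sum_add_distrib, ← Finset.mul_sum, hP, hsum]
      simp [hcard, mul_comm]
    rw [h4]
    simp only [Fintype.sum_bool, cond_true, cond_false]
    have h5 : 1 - lam = (d - 1) * mu := by linarith
    rw [h5, ← hmuP]
    have h6 : B = B * ((d - 1) * mu + lam) := by rw [hmul, mul_one]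
    have h7 : mu ^ 2 + B * mu + C = D / (mu + t) := by
      rw [eq_div_iff hmt.ne', hC, hB, hD]; ring
    have h8 : lam ^ 2 + B * lam + C = D / (lam + t) := by
      rw [eq_div_iff hlt.ne', hC, hB, hD]; ring
    have h9 : (d - 1) * mu ^ 2 + lam ^ 2 + B + C * d
        = (d - 1) * (D / (mu + t)) + D / (lam + t) := by
      rw [← h7, ← h8]; linear_combination h6
    rw [h9]
    field_simp
    ring

/-- At fixed sum and sum of squares, a triple `x > y ≥ z > 0` does not minimise
`∑ u / (u + t)`. -/
theorem exists_triple_sum_div_add_lt {x y z t : ℝ} (hxy : y < x) (hyz : z ≤ y) (hz : 0 < z)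
    (ht : 0 < t) : ∃ x' y' z' : ℝ, 0 ≤ x' ∧ 0 ≤ y' ∧ 0 ≤ z' ∧ x' + y' + z' = x + y + z ∧
      x' ^ 2 + y' ^ 2 + z' ^ 2 = x ^ 2 + y ^ 2 + z ^ 2 ∧
      x' / (x' + t) + y' / (y' + t) + z' / (z' + t) <
        x / (x + t) + y / (y + t) + z / (z + t) := by
  have hy : 0 < y := hz.trans_le hyz
  have hx : 0 < x := hy.trans hxy
  set ε := min z ((x - y) ^ 2 / (2 * (x + y))) with hε
  have hε0 : 0 < ε := by
    have : 0 < x - y := by linarith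
    exact lt_min hz (by positivity)
  have hεz : ε ≤ z := min_le_left _ _
  have hεd : ε * (2 * (x + y)) ≤ (x - y) ^ 2 := by
    rw [← le_div_iff₀ (by positivity)]; exact min_le_right _ _
  have hdisc : 0 ≤ (x - y) ^ 2 + ε * (4 * z - 2 * (x + y)) - 3 * ε ^ 2 := by nlinarith
  set r := Real.sqrt ((x - y) ^ 2 + ε * (4 * z - 2 * (x + y)) - 3 * ε ^ 2) with hr
  have hr0 : 0 ≤ r := Real.sqrt_nonneg _
  have hrsq : r ^ 2 = (x - y) ^ 2 + ε * (4 * z - 2 * (x + y)) - 3 * ε ^ 2 := Real.sq_sqrt hdisc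
  have hrle : r ≤ x + y + ε := by
    apply abs_le_of_sq_le_sq' _ (by positivity) |>.2
    rw [hrsq]; nlinarith [mul_pos hx hy, mul_pos hε0 hx, mul_pos hε0 hy]
  obtain ⟨x', hx'⟩ : ∃ x', x' = (x + y + ε + r) / 2 := ⟨_, rfl⟩
  obtain ⟨y', hy'⟩ : ∃ y', y' = (x + y + ε - r) / 2 := ⟨_, rfl⟩
  obtain ⟨z', hz'⟩ : ∃ z', z' = z - ε := ⟨_, rfl⟩
  have hx0 : 0 ≤ x' := by rw [hx']; positivity
  have hy0 : 0 ≤ y' := by rw [hy']; linarith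
  have hz0 : 0 ≤ z' := by rw [hz']; linarith
  have hsum : x' + y' + z' = x + y + z := by rw [hx', hy', hz']; ring
  have hprod : x' * y' = x * y + ε * (x + y - z) + ε ^ 2 := by
    rw [hx', hy']; linear_combination -hrsq / 4
  have he2 : x' * y' + y' * z' + z' * x' = x * y + y * z + z * x := by
    have : y' * z' + z' * x' = (x + y + ε) * z' := by rw [hx', hy']; ring
    rw [add_assoc, this, hprod, hz']; ring
  have he3 : x' * y' * z' < x * y * z := by
    rw [hprod, hz']
    have h1 : x * y * z - (x * y + ε * (x + y - z) + ε ^ 2) * (z - ε)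
        = ε * ((x - z) * (y - z) + ε * (x + y - 2 * z) + ε ^ 2) := by ring
    have h2 : 0 ≤ (x - z) * (y - z) := mul_nonneg (by linarith) (by linarith)
    have h3 : 0 < ε * (x + y - 2 * z) := mul_pos hε0 (by linarith)
    have : 0 < ε * ((x - z) * (y - z) + ε * (x + y - 2 * z) + ε ^ 2) := by positivity
    linarith
  refine ⟨x', y', z', hx0, hy0, hz0, hsum, ?_, ?_⟩
  · have h1 : (x' + y' + z') ^ 2 = (x + y + z) ^ 2 := by rw [hsum]
    linear_combination h1 - 2 * he2
  · have key : ∀ u v w : ℝ, 0 ≤ u → 0 ≤ v → 0 ≤ w → u / (u + t) + v / (v + t) + w / (w + t) =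
        3 - t * (3 * t ^ 2 + 2 * (u + v + w) * t + (u * v + v * w + w * u)) /
          (t ^ 3 + (u + v + w) * t ^ 2 + (u * v + v * w + w * u) * t + u * v * w) := by
      intro u v w hu hv hw
      have h1 : t ^ 3 + (u + v + w) * t ^ 2 + (u * v + v * w + w * u) * t + u * v * w =
        (u + t) * (v + t) * (w + t) := by ring
      rw [h1]
      have h2 : u + t ≠ 0 := by positivity
      have h3 : v + t ≠ 0 := by positivity
      have h4 : w + t ≠ 0 := by positivity
      field_simp
      ring
    rw [key _ _ _ hx0 hy0 hz0, key _ _ _ hx.le hy.le hz.le, hsum, he2]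
    have : 0 ≤ x' * y' * z' := by positivity
    gcongr

/-- If the two larger of any three positive entries of a unit-sum vector agree, the entries are
those prescribed by the purity. -/
theorem sum_div_add_eq_of_top_two_eq {ι : Type*} [Fintype ι] [DecidableEq ι] (p : ι → ℝ)
    (hp : ∀ i, 0 ≤ p i)
    (hsum : ∑ i, p i = 1) (P : ℝ) (hP : ∑ i, p i ^ 2 = P) (k : ℕ) (hk : 2 ≤ k)
    (hk1 : 1 / (k : ℝ) ≤ P) (hk2 : P ≤ 1 / ((k : ℝ) - 1))
    (htop : ∀ i j l, p j < p i → p l ≤ p j → 0 < p l → j = l)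
    (b : ℝ) (hb : b = 1 / (k : ℝ) - Real.sqrt ((1 - 1 / (k : ℝ)) * (P - 1 / (k : ℝ)))) (t : ℝ) :
    ∑ i, p i / (p i + t) = (1 - b) / ((1 - b) / ((k : ℝ) - 1) + t) + b / (b + t) := by
  have hk' : (2 : ℝ) ≤ k := by exact_mod_cast hk
  have hk0 : (0 : ℝ) < k := by linarith
  have hkm : (0 : ℝ) < (k : ℝ) - 1 := by linarith
  rw [div_le_iff₀ hk0] at hk1
  rw [le_div_iff₀ hkm] at hk2
  set s := Finset.univ.filter fun i => 0 < p i with hs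
  have hout : ∀ i, i ∉ s → p i = 0 := by
    intro i hi
    simp only [hs, Finset.mem_filter, Finset.mem_univ, true_and, not_lt] at hi
    exact le_antisymm hi (hp i)
  have hne : s.Nonempty := by
    by_contra h
    rw [Finset.not_nonempty_iff_eq_empty] at h
    have : ∑ i, p i = 0 := Finset.sum_eq_zero fun i _ => hout i (by simp [h])
    linarith
  obtain ⟨j, hjs, hj⟩ := s.exists_min_image p hne
  obtain ⟨m, hms, hm⟩ := s.exists_max_image p hne
  have hj0 : 0 < p j := by simpa [hs] using hjs
  have heq : ∀ i ∈ s.erase j, p i = p m := by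
    intro i hi
    rw [Finset.mem_erase] at hi
    by_contra h
    exact hi.1 (htop m i j (lt_of_le_of_ne (hm i hi.2) h) (hj i hi.2) hj0)
  have hsumf : ∀ f : ℝ → ℝ, f 0 = 0 →
      ∑ i, f (p i) = ((s.card : ℝ) - 1) * f (p m) + f (p j) := by
    intro f hf
    rw [← Finset.sum_subset (Finset.subset_univ s) (fun i _ hi => by rw [hout i hi, hf]),
      ← Finset.sum_erase_add _ _ hjs, Finset.sum_congr rfl fun i hi => by rw [heq i hi],
      Finset.sum_const, Finset.card_erase_of_mem hjs, nsmul_eq_mul,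
      Nat.cast_sub (Finset.card_pos.2 hne), Nat.cast_one]
  have h1 := hsumf id rfl
  have h2 := hsumf (fun u => u ^ 2) (by simp)
  simp only [id] at h1
  rw [hsum] at h1
  rw [hP] at h2
  rw [hsumf (fun u => u / (u + t)) (by simp)]
  have hc1 : 1 ≤ s.card := Finset.card_pos.2 hne
  set n := s.card with hn
  have hn1 : (1 : ℝ) ≤ n := by exact_mod_cast hc1
  have hjm : p j ≤ p m := hm j hjs
  set a := p m with ha
  set c := p j with hc
  have hmP : 1 ≤ n * P := by
    have : (n : ℝ) * P - 1 = (n - 1) * (a - c) ^ 2 := by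
      have h3 : (1 : ℝ) = (((n : ℝ) - 1) * a + c) ^ 2 := by rw [← h1]; norm_num
      rw [h2]; linear_combination -h3
    nlinarith [mul_nonneg (sub_nonneg.2 hn1) (sq_nonneg (a - c))]
  have hmP' : ((n : ℝ) - 1) * P < 1 := by
    have : 1 - ((n : ℝ) - 1) * P = c * (2 * (n - 1) * a + c - (n - 1) * c) := by
      have h3 : (1 : ℝ) = (((n : ℝ) - 1) * a + c) ^ 2 := by rw [← h1]; norm_num
      rw [h2]; linear_combination h3
    have h4 : 0 < 2 * (n - 1) * a + c - (n - 1) * c := by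
      nlinarith [mul_nonneg (sub_nonneg.2 hn1) (sub_nonneg.2 hjm),
        mul_nonneg (sub_nonneg.2 hn1) hj0.le, mul_nonneg (sub_nonneg.2 hn1) (hj0.le.trans hjm)]
    have := mul_pos hj0 h4
    linarith
  have hP0 : 0 < P := by
    by_contra h
    nlinarith
  have hnk : n ≤ k := by
    have : (n : ℝ) - 1 < k := lt_of_mul_lt_mul_right (by linarith) hP0.le
    have : (n : ℝ) < (k + 1 : ℕ) := by push_cast; linarith
    have : n < k + 1 := by exact_mod_cast this
    omega
  have hkn : k ≤ n + 1 := by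
    have : (k : ℝ) - 1 ≤ n := le_of_mul_le_mul_right (by linarith) hP0
    have : (k : ℝ) ≤ (n + 1 : ℕ) := by push_cast; linarith
    exact_mod_cast this
  rcases Nat.lt_or_ge n k with h | h
  · have hk3 : k = n + 1 := by omega
    have hk4 : (k : ℝ) = n + 1 := by rw [hk3]; push_cast; ring
    have hn0 : (n : ℝ) ≠ 0 := by linarith
    have hPn : P = 1 / n := by
      rw [eq_div_iff hn0]
      rw [hk4] at hk2
      linarith
    have hb0 : b = 0 := by
      have h5 : (1 - 1 / (k : ℝ)) * (P - 1 / (k : ℝ)) = (1 / (k : ℝ)) ^ 2 := by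
        rw [hPn, hk4]
        have : (n : ℝ) + 1 ≠ 0 := by linarith
        field_simp
        ring
      rw [hb, h5, Real.sqrt_sq (by positivity), sub_self]
    have hac : (n - 1) * (a - c) ^ 2 = 0 := by
      have h3 : (1 : ℝ) = (((n : ℝ) - 1) * a + c) ^ 2 := by rw [← h1]; norm_num
      have h4 : (n : ℝ) * P = 1 := by rw [hPn]; field_simp
      rw [h2] at h4; linear_combination h4 + h3
    have hcn : c = 1 / n ∧ (n - 1) * (a / (a + t)) = (n - 1) * (c / (c + t)) := by
      rcases mul_eq_zero.1 hac with h6 | h6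
      · rw [h6] at h1 ⊢
        have : (n : ℝ) = 1 := by linarith
        rw [this]
        constructor <;> linarith
      · have h7 : a = c := by
          have := pow_eq_zero_iff (two_ne_zero) |>.1 h6
          linarith
        rw [h7] at h1 ⊢
        refine ⟨?_, rfl⟩
        rw [eq_div_iff hn0]; linarith
    rw [hcn.2, hb0, hcn.1, hk4]
    simp
    field_simp
    ring
  · have hk3 : n = k := by omega
    rw [hk3] at h1 h2
    have ha' : a = (1 - c) / ((k : ℝ) - 1) := by
      rw [eq_div_iff hkm.ne']; linarith
    have hck : (k : ℝ) * c ≤ 1 := by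
      nlinarith [mul_nonneg hkm.le (sub_nonneg.2 hjm)]
    have hbc : b = c := by
      have h5 : (1 - 1 / (k : ℝ)) * (P - 1 / (k : ℝ)) = (1 / (k : ℝ) - c) ^ 2 := by
        have h6 : ((k : ℝ) - 1) * P = (1 - c) ^ 2 + (k - 1) * c ^ 2 := by
          have h7 : (1 - c) = (k - 1) * a := by linarith
          rw [h7, h2]; ring
        field_simp
        linear_combination k * h6
      rw [hb, h5, Real.sqrt_sq (by rw [sub_nonneg, le_div_iff₀ hk0]; linarith)]
      ring
    rw [hbc, hk3, ← ha']
    have h8 : 1 - c = (k - 1) * a := by linarith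
    rw [h8, mul_div_assoc]

/-- Shannon entropy at fixed purity is at least that of a vector whose positive entries all agree
except for possibly one smaller entry. -/
theorem Lent_le_entropy {ι : Type*} [Fintype ι]
    (p : ι → ℝ) (hp : ∀ i, 0 ≤ p i) (hsum : ∑ i, p i = 1) (P : ℝ) (hP : ∑ i, p i ^ 2 = P)
    (k : ℕ) (hk : 2 ≤ k) (hk1 : 1 / (k : ℝ) ≤ P) (hk2 : P ≤ 1 / ((k : ℝ) - 1)) :
    Lent P k ≤ -∑ i, p i * Real.log (p i) := by
  classical
  have hk' : (2 : ℝ) ≤ k := by exact_mod_cast hk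
  have hk0 : (0 : ℝ) < k := by linarith
  have hkm : (0 : ℝ) < (k : ℝ) - 1 := by linarith
  obtain ⟨b, hb⟩ : ∃ b, b = 1 / (k : ℝ) - Real.sqrt ((1 - 1 / (k : ℝ)) * (P - 1 / (k : ℝ))) :=
    ⟨_, rfl⟩
  have hb0 : 0 ≤ b := by
    rw [hb, sub_nonneg, Real.sqrt_le_left (by positivity)]
    have h1 : P - 1 / (k : ℝ) ≤ 1 / ((k : ℝ) - 1) - 1 / k := by linarith
    have h2 : 0 ≤ 1 - 1 / (k : ℝ) := by rw [sub_nonneg, div_le_one hk0]; linarith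
    refine (mul_le_mul_of_nonneg_left h1 h2).trans (le_of_eq ?_)
    field_simp
    ring
  have hb1 : b < 1 := by
    have h1 : 1 / (k : ℝ) < 1 := by rw [div_lt_one hk0]; linarith
    have := Real.sqrt_nonneg ((1 - 1 / (k : ℝ)) * (P - 1 / (k : ℝ)))
    linarith
  have hL : Lent P k =
      -∑ j : Bool, (cond j b (1 - b)) * Real.log (cond j b ((1 - b) / ((k : ℝ) - 1))) := by
    simp only [Lent, Fintype.sum_bool, cond_true, cond_false, ← hb]
    ring
  rw [hL]
  refine neg_sum_mul_log_le_of_sum_div_add_le _ _ p p ?_ ?_ ?_ ?_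
  · rintro (_ | _)
    · exact Or.inl (div_pos (by simpa using hb1) hkm)
    · rcases hb0.lt_or_eq with h | h
      · exact Or.inl h
      · exact Or.inr ⟨h.symm, h.symm⟩
  · intro i
    rcases (hp i).lt_or_eq with h | h
    · exact Or.inl h
    · exact Or.inr ⟨h.symm, h.symm⟩
  · simp [hsum]
  · intro t ht
    let K : Set (ι → ℝ) := {q | (∀ i, 0 ≤ q i) ∧ ∑ i, q i = 1 ∧ ∑ i, q i ^ 2 = P}
    have hKc : IsCompact K := by
      have hsub : K ⊆ Set.pi Set.univ fun _ => Set.Icc (0 : ℝ) 1 := by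
        rintro q ⟨hq, hq1, -⟩ i -
        exact ⟨hq i, hq1 ▸ Finset.single_le_sum (fun j _ => hq j) (Finset.mem_univ i)⟩
      refine (isCompact_univ_pi fun _ => isCompact_Icc).of_isClosed_subset ?_ hsub
      refine IsClosed.inter ?_ (IsClosed.inter ?_ ?_)
      · exact isClosed_Ici (a := (0 : ι → ℝ))
      · exact isClosed_eq (by fun_prop) continuous_const
      · exact isClosed_eq (by fun_prop) continuous_const
    have hcont : ContinuousOn (fun q : ι → ℝ => ∑ i, q i / (q i + t)) K := by
      refine continuousOn_finsetSum _ fun i _ => ContinuousOn.div (by fun_prop) (by fun_prop) ?_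
      rintro q ⟨hq, -, -⟩
      have := hq i
      positivity
    obtain ⟨q, ⟨hq, hq1, hq2⟩, hqmin⟩ := hKc.exists_isMinOn ⟨p, hp, hsum, hP⟩ hcont
    have htop : ∀ i j l, q j < q i → q l ≤ q j → 0 < q l → j = l := by
      intro i j l hij hjl hl
      by_contra hne
      have hil : i ≠ l := by rintro rfl; linarith
      have hij' : i ≠ j := by rintro rfl; linarith
      obtain ⟨x, y, z, hx, hy, hz, e1, e2, hlt⟩ := exists_triple_sum_div_add_lt hij hjl hl ht
      let q' : ι → ℝ := Function.update (Function.update (Function.update q i x) j y) l z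
      have hi' : q' i = x := by simp [q', hil, hij']
      have hj' : q' j = y := by simp [q', hne]
      have hl' : q' l = z := by simp [q']
      have hother : ∀ m, m ≠ i → m ≠ j → m ≠ l → q' m = q m := by
        intro m h1 h2 h3
        simp [q', h1, h2, h3]
      have split : ∀ (f : ℝ → ℝ) (v : ι → ℝ), ∑ m, f (v m) = f (v i) + f (v j) + f (v l) +
          ∑ m ∈ ((Finset.univ.erase i).erase j).erase l, f (v m) := by
        intro f v
        rw [← Finset.add_sum_erase _ _ (Finset.mem_univ i), ← Finset.add_sum_erase
          (Finset.univ.erase i) _ (a := j) (by simp [hij'.symm]), ← Finset.add_sum_erase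
          ((Finset.univ.erase i).erase j) _ (a := l) (by simp [hil.symm, Ne.symm hne])]
        ring
      have diff : ∀ f : ℝ → ℝ, ∑ m, f (q' m) - ∑ m, f (q m) =
          f x + f y + f z - (f (q i) + f (q j) + f (q l)) := by
        intro f
        rw [split f q', split f q, hi', hj', hl', Finset.sum_congr rfl fun m hm => by
          simp only [Finset.mem_erase] at hm
          rw [hother m hm.2.2.1 hm.2.1 hm.1]]
        ring
      have hmem : q' ∈ K := by
        refine ⟨?_, ?_, ?_⟩
        · intro m
          by_cases h1 : m = l
          · rw [h1, hl']; exact hz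
          by_cases h2 : m = j
          · rw [h2, hj']; exact hy
          by_cases h3 : m = i
          · rw [h3, hi']; exact hx
          rw [hother m h3 h2 h1]; exact hq m
        · have := diff id
          simp only [id] at this
          linarith
        · have := diff fun u => u ^ 2
          linarith
      have h1 := hqmin hmem
      simp only [Set.mem_ofPred_eq] at h1
      have h2 := diff fun u => u / (u + t)
      linarith
    have h1 := hqmin (show p ∈ K from ⟨hp, hsum, hP⟩)
    simp only [Set.mem_ofPred_eq] at h1
    rw [sum_div_add_eq_of_top_two_eq q hq hq1 P hq2 k hk hk1 hk2 htop b hb t] at h1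
    simp only [Fintype.sum_bool, cond_true, cond_false]
    linarith

section

open Matrix

theorem vN_eq_sum_roots {n : Type*} [Fintype n] [DecidableEq n] {M : Matrix n n ℂ}
    (h : M.IsHermitian) :
    vN M = (M.charpoly.roots.map fun z => Real.negMulLog z.re).sum := by
  rw [vN, dif_pos h, h.roots_charpoly_eq_eigenvalues, Multiset.map_map, ← Finset.sum_neg_distrib]
  simp [Real.negMulLog]

theorem vN_eq_of_charpoly_eq {n m : Type*} [Fintype n] [DecidableEq n] [Fintype m]
    [DecidableEq m] {M : Matrix n n ℂ} {N : Matrix m m ℂ} (hM : M.IsHermitian)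
    (hN : N.IsHermitian) (h : M.charpoly = N.charpoly) : vN M = vN N := by
  rw [vN_eq_sum_roots hM, vN_eq_sum_roots hN, h]

theorem vN_transpose {n : Type*} [Fintype n] [DecidableEq n] {M : Matrix n n ℂ}
    (h : M.IsHermitian) : vN Mᵀ = vN M :=
  vN_eq_of_charpoly_eq h.transpose h (charpoly_transpose M)

theorem vN_submatrix_equiv {n m : Type*} [Fintype n] [DecidableEq n] [Fintype m]
    [DecidableEq m] {M : Matrix n n ℂ} (h : M.IsHermitian) (e : m ≃ n) :
    vN (M.submatrix e e) = vN M :=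
  vN_eq_of_charpoly_eq (h.submatrix e) h (charpoly_reindex e.symm M)

/-- The two marginals of a pure state have the same entropy. -/
theorem vN_mul_conjTranspose_self {n m : Type*} [Fintype n] [DecidableEq n] [Fintype m]
    [DecidableEq m] (N : Matrix n m ℂ) : vN (N * Nᴴ) = vN (Nᴴ * N) := by
  rw [vN_eq_sum_roots (isHermitian_mul_conjTranspose_self N),
    vN_eq_sum_roots (isHermitian_conjTranspose_mul_self N)]
  have key : ∀ (p : Polynomial ℂ) (k : ℕ), p ≠ 0 →
      ((Polynomial.X ^ k * p).roots.map fun z : ℂ => Real.negMulLog z.re).sum =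
        (p.roots.map fun z : ℂ => Real.negMulLog z.re).sum := by
    intro p k hp
    rw [Polynomial.roots_mul (mul_ne_zero (pow_ne_zero _ Polynomial.X_ne_zero) hp)]
    simp [Multiset.map_nsmul, Multiset.sum_nsmul]
  rw [← key _ (Fintype.card m) (charpoly_monic _).ne_zero, charpoly_mul_comm',
    key _ _ (charpoly_monic _).ne_zero]

theorem exists_unitary_diagonalization {n : Type*} [Fintype n] [DecidableEq n]
    {M : Matrix n n ℂ} (h : M.IsHermitian) : ∃ U : Matrix n n ℂ, Uᴴ * U = 1 ∧ U * Uᴴ = 1 ∧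
      M = U * diagonal (fun i => (h.eigenvalues i : ℂ)) * Uᴴ :=
  ⟨h.eigenvectorUnitary, mem_unitaryGroup_iff'.1 h.eigenvectorUnitary.2,
    mem_unitaryGroup_iff.1 h.eigenvectorUnitary.2, h.spectral_theorem⟩

theorem continuous_vN_add_smul_one {n : Type*} [Fintype n] [DecidableEq n]
    {M : Matrix n n ℂ} (h : M.IsHermitian) :
    Continuous fun c : ℝ => vN (M + (c : ℂ) • (1 : Matrix n n ℂ)) := by
  obtain ⟨U, hU, hU', hM⟩ := exists_unitary_diagonalization h
  have key : ∀ c : ℝ, vN (M + (c : ℂ) • (1 : Matrix n n ℂ)) =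
      ∑ i, Real.negMulLog (h.eigenvalues i + c) := by
    intro c
    have hherm : (M + (c : ℂ) • (1 : Matrix n n ℂ)).IsHermitian := by
      refine h.add ?_
      rw [IsHermitian, conjTranspose_smul, conjTranspose_one, Complex.star_def,
        Complex.conj_ofReal]
    have h1 : M + (c : ℂ) • (1 : Matrix n n ℂ) =
        U * diagonal (fun i => ((h.eigenvalues i + c : ℝ) : ℂ)) * Uᴴ := by
      have h2 : diagonal (fun i => ((h.eigenvalues i + c : ℝ) : ℂ)) =
          diagonal (fun i => (h.eigenvalues i : ℂ)) + (c : ℂ) • (1 : Matrix n n ℂ) := by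
        rw [smul_one_eq_diagonal, diagonal_add]
        simp
      rw [h2, Matrix.mul_add, Matrix.add_mul, ← hM]
      simp [hU']
    have h3 : (M + (c : ℂ) • (1 : Matrix n n ℂ)).charpoly =
        (diagonal (fun i => ((h.eigenvalues i + c : ℝ) : ℂ))).charpoly := by
      rw [h1, charpoly_mul_comm, ← Matrix.mul_assoc, hU, Matrix.one_mul]
    rw [vN_eq_sum_roots hherm, h3, charpoly_diagonal, Polynomial.roots_prod _ _
      (Finset.prod_ne_zero_iff.2 fun i _ => Polynomial.X_sub_C_ne_zero _)]
    simp only [Polynomial.roots_X_sub_C]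
    simp
  simp only [key]
  exact continuous_finsetSum _ fun i _ =>
    Real.continuous_negMulLog.comp (continuous_const.add continuous_id)

/-- The concave quadratic form in `X` whose supremum is
`⟨ρ^{1/2}, (Δ + t)⁻¹ ρ^{1/2}⟩` for the relative modular operator `Δ` of `σ` and `ρ`. It is affine
in `(ρ, σ)`, which makes its supremum monotone under partial traces. -/
noncomputable def modularForm {n : Type*} [Fintype n] (ρ σ : Matrix n n ℂ) (t : ℝ)
    (X : Matrix n n ℂ) : ℝ :=
  (2 * (ρ * X).trace - (σ * (X * Xᴴ)).trace - t * (ρ * (Xᴴ * X)).trace).re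

theorem trace_diagonal_mul_mul {n m : Type*} [Fintype n] [DecidableEq n] [Fintype m]
    (d : n → ℂ) (M : Matrix n m ℂ) (N : Matrix m n ℂ) :
    (diagonal d * (M * N)).trace = ∑ i, ∑ j, d i * (M i j * N j i) := by
  simp only [trace, diag_apply, diagonal_mul]
  simp only [Matrix.mul_apply, Finset.mul_sum]

theorem modularForm_conj {n : Type*} [Fintype n] [DecidableEq n] (U V : Matrix n n ℂ)
    (hU : Uᴴ * U = 1) (hV : Vᴴ * V = 1) (p q : n → ℝ) (t : ℝ) (Y : Matrix n n ℂ) :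
    modularForm (U * diagonal (fun i => (p i : ℂ)) * Uᴴ) (V * diagonal (fun i => (q i : ℂ)) * Vᴴ)
      t (V * Y * Uᴴ) = ∑ i, ∑ j, (2 * p i * ((Uᴴ * V) i j * Y j i).re -
        (q j + t * p i) * Complex.normSq (Y j i)) := by
  have cancel : ∀ {W : Matrix n n ℂ}, Wᴴ * W = 1 → ∀ Z : Matrix n n ℂ, Wᴴ * (W * Z) = Z := by
    intro W hW Z
    rw [← Matrix.mul_assoc, hW, Matrix.one_mul]
  have h1 : (U * diagonal (fun i => (p i : ℂ)) * Uᴴ * (V * Y * Uᴴ)).trace =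
      ∑ i, ∑ j, (p i : ℂ) * ((Uᴴ * V) i j * Y j i) := by
    rw [← trace_diagonal_mul_mul, ← Matrix.mul_assoc _ _ Uᴴ, trace_mul_comm]
    simp only [Matrix.mul_assoc, cancel hU]
  have h2 : (V * diagonal (fun i => (q i : ℂ)) * Vᴴ * (V * Y * Uᴴ * (V * Y * Uᴴ)ᴴ)).trace =
      ∑ j, ∑ i, (q j : ℂ) * (Y j i * Yᴴ i j) := by
    rw [← trace_diagonal_mul_mul]
    have : V * diagonal (fun i => (q i : ℂ)) * Vᴴ * (V * Y * Uᴴ * (V * Y * Uᴴ)ᴴ) =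
        V * (diagonal (fun i => (q i : ℂ)) * (Y * Yᴴ)) * Vᴴ := by
      simp only [conjTranspose_mul, conjTranspose_conjTranspose, Matrix.mul_assoc, cancel hU,
        cancel hV]
    rw [this, trace_mul_comm, ← Matrix.mul_assoc, hV, Matrix.one_mul]
  have h3 : (U * diagonal (fun i => (p i : ℂ)) * Uᴴ * ((V * Y * Uᴴ)ᴴ * (V * Y * Uᴴ))).trace =
      ∑ i, ∑ j, (p i : ℂ) * (Yᴴ i j * Y j i) := by
    rw [← trace_diagonal_mul_mul]
    have : U * diagonal (fun i => (p i : ℂ)) * Uᴴ * ((V * Y * Uᴴ)ᴴ * (V * Y * Uᴴ)) =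
        U * (diagonal (fun i => (p i : ℂ)) * (Yᴴ * Y)) * Uᴴ := by
      simp only [conjTranspose_mul, conjTranspose_conjTranspose, Matrix.mul_assoc, cancel hU,
        cancel hV]
    rw [this, trace_mul_comm, ← Matrix.mul_assoc, hU, Matrix.one_mul]
  rw [modularForm, h1, h2, h3, Finset.sum_comm (γ := n) (f := fun j i => (q j : ℂ) * _)]
  simp only [Finset.mul_sum, ← Finset.sum_sub_distrib, Complex.re_sum]
  refine Finset.sum_congr rfl fun i _ => Finset.sum_congr rfl fun j _ => ?_
  simp only [conjTranspose_apply, Complex.star_def, mul_comm ((starRingEnd ℂ) (Y j i)),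
    Complex.mul_conj, Complex.sub_re, ← Complex.ofReal_mul, Complex.ofReal_re]
  have : (2 * ((p i : ℂ) * ((Uᴴ * V) i j * Y j i))).re =
      2 * p i * ((Uᴴ * V) i j * Y j i).re := by
    rw [show (2 : ℂ) = ((2 : ℝ) : ℂ) by norm_num, Complex.re_ofReal_mul, Complex.re_ofReal_mul]
    ring
  rw [this]
  ring

theorem two_mul_re_sub_normSq_le (p s : ℝ) (hs : 0 < s) (w y : ℂ) :
    2 * p * (w * y).re - s * Complex.normSq y ≤ Complex.normSq w * p ^ 2 / s := by
  rw [le_div_iff₀ hs]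
  have h := Complex.normSq_nonneg (s * y - p * (starRingEnd ℂ) w)
  simp only [Complex.normSq_apply, Complex.sub_re, Complex.sub_im, Complex.mul_re,
    Complex.mul_im, Complex.ofReal_re, Complex.ofReal_im, Complex.conj_re, Complex.conj_im] at h ⊢
  nlinarith

theorem isGreatest_modularForm {n : Type*} [Fintype n] [DecidableEq n] (U V : Matrix n n ℂ)
    (hU : Uᴴ * U = 1) (hV : Vᴴ * V = 1) (p q : n → ℝ) (hp : ∀ i, 0 < p i) (hq : ∀ i, 0 < q i)
    (t : ℝ) (ht : 0 < t) :
    IsGreatest (Set.range (modularForm (U * diagonal (fun i => (p i : ℂ)) * Uᴴ)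
      (V * diagonal (fun i => (q i : ℂ)) * Vᴴ) t))
      (∑ i, ∑ j, Complex.normSq ((Uᴴ * V) i j) * p i ^ 2 / (q j + t * p i)) := by
  have hs : ∀ i j, 0 < q j + t * p i := fun i j => by
    have := hp i
    have := hq j
    positivity
  constructor
  · refine ⟨V * Matrix.of (fun j i => ((p i / (q j + t * p i) : ℝ) : ℂ) *
      (starRingEnd ℂ) ((Uᴴ * V) i j)) * Uᴴ, ?_⟩
    rw [modularForm_conj U V hU hV]
    refine Finset.sum_congr rfl fun i _ => Finset.sum_congr rfl fun j _ => ?_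
    have := (hs i j).ne'
    rw [of_apply, mul_left_comm, Complex.mul_conj, Complex.re_ofReal_mul, Complex.ofReal_re,
      Complex.normSq_mul, Complex.normSq_conj, Complex.normSq_ofReal]
    field_simp
    ring
  · rintro _ ⟨X, rfl⟩
    have hX : X = V * (Vᴴ * X * U) * Uᴴ := by
      have hU' : U * Uᴴ = 1 := mul_eq_one_comm.1 hU
      have hV' : V * Vᴴ = 1 := mul_eq_one_comm.1 hV
      rw [← Matrix.mul_assoc, ← Matrix.mul_assoc, hV', Matrix.one_mul, Matrix.mul_assoc, hU',
        Matrix.mul_one]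
    rw [hX, modularForm_conj U V hU hV]
    exact Finset.sum_le_sum fun i _ => Finset.sum_le_sum fun j _ =>
      two_mul_re_sub_normSq_le _ _ (hs i j) _ _

theorem ptraceA_conj_one_kronecker {A D : Type*} [Fintype A] [DecidableEq A] [Fintype D]
    (R : Matrix (A × D) (A × D) ℂ) (v : Matrix D D ℂ) :
    ptraceA (((1 : Matrix A A ℂ) ⊗ₖ v)ᴴ * R * ((1 : Matrix A A ℂ) ⊗ₖ v)) =
      vᴴ * ptraceA R * v := by
  ext m m'
  simp only [ptraceA, of_apply, Matrix.mul_apply, Fintype.sum_prod_type, kroneckerMap_apply,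
    one_apply, conjTranspose_apply, Finset.sum_mul, Finset.mul_sum, apply_ite star,
    star_zero, ite_mul, mul_ite, one_mul, zero_mul, mul_zero,
    Finset.sum_ite_irrel, Finset.sum_const_zero, Finset.sum_ite_eq',
    Finset.mem_univ, if_true]
  rw [Finset.sum_comm]
  refine Finset.sum_congr rfl fun x _ => ?_
  rw [Finset.sum_comm]

/-- The conditional entropy of a positive definite bipartite operator is a logarithmic moment whose
Stieltjes transform is given by the variational form `modularForm`. -/
theorem exists_condEntropy_representation {A D : Type*} [Fintype A] [DecidableEq A] [Fintype D]
    [DecidableEq D] (R : Matrix (A × D) (A × D) ℂ) (hR : R.PosDef) (hD : (ptraceA R).PosDef) :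
    ∃ a x : (A × D) × (A × D) → ℝ, (∀ i, 0 < x i) ∧ ∑ i, a i = R.trace.re ∧
      -∑ i, a i * Real.log (x i) = vN (ptraceA R) - vN R ∧
      ∀ t : ℝ, 0 < t → IsGreatest
        (Set.range (modularForm R ((1 : Matrix A A ℂ) ⊗ₖ ptraceA R) t)) (∑ i, a i / (x i + t)) := by
  obtain ⟨U, hU, hU', hRU⟩ := exists_unitary_diagonalization hR.1
  obtain ⟨v, hv, hv', hDv⟩ := exists_unitary_diagonalization hD.1
  have hp := hR.eigenvalues_pos
  have hq := hD.eigenvalues_pos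
  have hvN : vN R = -∑ i, hR.1.eigenvalues i * Real.log (hR.1.eigenvalues i) := dif_pos hR.1
  have hvN' : vN (ptraceA R) = -∑ i, hD.1.eigenvalues i * Real.log (hD.1.eigenvalues i) :=
    dif_pos hD.1
  set p := hR.1.eigenvalues
  set q := hD.1.eigenvalues
  set V : Matrix (A × D) (A × D) ℂ := (1 : Matrix A A ℂ) ⊗ₖ v with hVdef
  have hV : Vᴴ * V = 1 := by
    rw [hVdef, conjTranspose_kronecker, ← mul_kronecker_mul, hv]; simp
  have hV' : V * Vᴴ = 1 := mul_eq_one_comm.1 hV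
  have hσ : (1 : Matrix A A ℂ) ⊗ₖ ptraceA R =
      V * diagonal (fun i : A × D => (q i.2 : ℂ)) * Vᴴ := by
    have h1 : diagonal (fun i : A × D => (q i.2 : ℂ)) =
        (1 : Matrix A A ℂ) ⊗ₖ diagonal (fun i => (q i : ℂ)) := by
      rw [← diagonal_one, diagonal_kronecker_diagonal]; simp
    rw [h1, hVdef, conjTranspose_kronecker, ← mul_kronecker_mul, ← mul_kronecker_mul, ← hDv]
    simp
  have hrow : ∀ i, ∑ j, Complex.normSq ((Uᴴ * V) i j) = 1 := by
    intro i
    have h1 : (Uᴴ * V) * (Uᴴ * V)ᴴ = 1 := by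
      rw [conjTranspose_mul, conjTranspose_conjTranspose, Matrix.mul_assoc, ← Matrix.mul_assoc V,
        hV', Matrix.one_mul, hU]
    have h2 := congrFun (congrFun h1 i) i
    rw [Matrix.mul_apply, one_apply_eq] at h2
    simp only [conjTranspose_apply, Complex.star_def, Complex.mul_conj] at h2
    exact_mod_cast h2
  have hcol : ∀ j, ((∑ i, Complex.normSq ((Uᴴ * V) i j) * p i : ℝ) : ℂ) = (Vᴴ * R * V) j j := by
    intro j
    have h1 : Vᴴ * R * V = (Uᴴ * V)ᴴ * (diagonal (fun i => (p i : ℂ)) * (Uᴴ * V)) := by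
      conv_lhs => rw [hRU]
      simp only [conjTranspose_mul, conjTranspose_conjTranspose, Matrix.mul_assoc]
    rw [h1, Matrix.mul_apply]
    push_cast
    refine Finset.sum_congr rfl fun i _ => ?_
    rw [diagonal_mul, conjTranspose_apply, Complex.star_def, Complex.normSq_eq_conj_mul_self]
    ring
  have hmarg : ∀ m, ∑ c : A, ∑ i, Complex.normSq ((Uᴴ * V) i (c, m)) * p i = q m := by
    intro m
    have h1 := congrFun (congrFun (ptraceA_conj_one_kronecker R v) m) m
    rw [← hVdef] at h1
    have h2 : vᴴ * ptraceA R * v = diagonal (fun i => (q i : ℂ)) := by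
      conv_lhs => rw [hDv]
      rw [← Matrix.mul_assoc, ← Matrix.mul_assoc, hv, Matrix.one_mul, Matrix.mul_assoc, hv,
        Matrix.mul_one]
    rw [h2, diagonal_apply_eq] at h1
    simp only [ptraceA, of_apply, ← hcol] at h1
    exact_mod_cast h1
  refine ⟨fun ij => Complex.normSq ((Uᴴ * V) ij.1 ij.2) * p ij.1, fun ij => q ij.2.2 / p ij.1,
    fun ij => div_pos (hq _) (hp _), ?_, ?_, ?_⟩
  · rw [Fintype.sum_prod_type]
    simp only [← Finset.sum_mul, hrow, one_mul]
    rw [hR.1.trace_eq_sum_eigenvalues]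
    simp [p]
  · have h1 : ∀ i j, Complex.normSq ((Uᴴ * V) i j) * p i * Real.log (q j.2 / p i) =
        Complex.normSq ((Uᴴ * V) i j) * p i * Real.log (q j.2) -
          Complex.normSq ((Uᴴ * V) i j) * (p i * Real.log (p i)) := by
      intro i j
      rw [Real.log_div (hq _).ne' (hp _).ne']; ring
    rw [Fintype.sum_prod_type]
    simp only [h1, Finset.sum_sub_distrib, ← Finset.sum_mul, hrow, one_mul]
    rw [Finset.sum_comm]
    simp only [← Finset.sum_mul]
    rw [Fintype.sum_prod_type, Finset.sum_comm]
    simp only [← Finset.sum_mul, hmarg]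
    rw [hvN, hvN']
    ring
  · intro t ht
    have h1 := isGreatest_modularForm U V hU hV p (fun i : A × D => q i.2) hp (fun i => hq i.2) t ht
    rw [hσ]
    conv in modularForm R => rw [hRU]
    convert h1 using 1
    rw [Fintype.sum_prod_type]
    refine Finset.sum_congr rfl fun i _ => Finset.sum_congr rfl fun j _ => ?_
    have h2 := (hp i).ne'
    have h3 : q j.2 + t * p i ≠ 0 := by
      have := hp i
      have := hq j.2
      positivity
    have h4 : q j.2 / p i + t = (q j.2 + t * p i) / p i := by field_simp
    simp only
    rw [h4]
    field_simp

/-- The embedding `X_AC ↦ X_AC ⊗ 1_B`. -/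
def midExt {A C : Type*} (B : Type*) [DecidableEq B] (X : Matrix (A × C) (A × C) ℂ) :
    Matrix (A × B × C) (A × B × C) ℂ :=
  Matrix.of fun x y => if x.2.1 = y.2.1 then X (x.1, x.2.2) (y.1, y.2.2) else 0

section

variable {A B C : Type*}

theorem midExt_conjTranspose [DecidableEq B] (X : Matrix (A × C) (A × C) ℂ) :
    (midExt B X)ᴴ = midExt B Xᴴ := by
  ext x y
  simp [midExt, apply_ite (starRingEnd ℂ), eq_comm]

theorem midExt_mul [Fintype A] [Fintype B] [DecidableEq B] [Fintype C]
    (X Y : Matrix (A × C) (A × C) ℂ) : midExt B X * midExt B Y = midExt B (X * Y) := by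
  ext x y
  simp only [midExt, Matrix.mul_apply, of_apply, Fintype.sum_prod_type, ite_mul, mul_ite, zero_mul,
    mul_zero, Finset.sum_ite_irrel, Finset.sum_const_zero, Finset.sum_ite_eq',
    Finset.mem_univ, if_true]

theorem trace_mul_midExt [Fintype A] [Fintype B] [DecidableEq B] [Fintype C]
    (R : Matrix (A × B × C) (A × B × C) ℂ) (X : Matrix (A × C) (A × C) ℂ) :
    (R * midExt B X).trace = (ptraceB3 R * X).trace := by
  simp only [midExt, ptraceB3, trace, diag_apply, Matrix.mul_apply, of_apply,
    Fintype.sum_prod_type, mul_ite, mul_zero, Finset.sum_ite_irrel, Finset.sum_const_zero,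
    Finset.sum_ite_eq', Finset.mem_univ, if_true, Finset.sum_mul]
  refine Finset.sum_congr rfl fun a _ => ?_
  rw [Finset.sum_comm]
  refine Finset.sum_congr rfl fun c _ => ?_
  rw [Finset.sum_comm]
  refine Finset.sum_congr rfl fun a' _ => ?_
  rw [Finset.sum_comm]

theorem ptraceB3_one_kronecker [DecidableEq A] [Fintype B] (S : Matrix (B × C) (B × C) ℂ) :
    ptraceB3 ((1 : Matrix A A ℂ) ⊗ₖ S) = (1 : Matrix A A ℂ) ⊗ₖ ptraceA S := by
  ext x y
  simp [ptraceB3, ptraceA, kroneckerMap_apply, Finset.mul_sum]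

theorem ptraceA_ptraceB3 [Fintype A] [Fintype B] (R : Matrix (A × B × C) (A × B × C) ℂ) :
    ptraceA (ptraceB3 R) = ptraceA (ptraceA R) := by
  ext x y
  simp only [ptraceB3, ptraceA, of_apply]
  exact Finset.sum_comm

theorem trace_ptraceB3 [Fintype A] [Fintype B] [Fintype C]
    (R : Matrix (A × B × C) (A × B × C) ℂ) : (ptraceB3 R).trace = R.trace := by
  simp only [ptraceB3, trace, diag_apply, of_apply, Fintype.sum_prod_type]
  exact Finset.sum_congr rfl fun a _ => Finset.sum_comm

theorem modularForm_midExt [Fintype A] [Fintype B] [DecidableEq B] [Fintype C]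
    (R S : Matrix (A × B × C) (A × B × C) ℂ) (t : ℝ) (X : Matrix (A × C) (A × C) ℂ) :
    modularForm R S t (midExt B X) = modularForm (ptraceB3 R) (ptraceB3 S) t X := by
  simp only [modularForm, midExt_conjTranspose, midExt_mul, trace_mul_midExt]

/-- Strong subadditivity for positive definite operators. -/
theorem condMutualInfo_nonneg_of_posDef [Fintype A] [DecidableEq A] [Fintype B] [DecidableEq B]
    [Fintype C] [DecidableEq C]
    (R : Matrix (A × B × C) (A × B × C) ℂ) (hR : R.PosDef)
    (hAC : (ptraceB3 R).PosDef) (hBC : (ptraceA R).PosDef) (hC : (ptraceA (ptraceA R)).PosDef) :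
    0 ≤ condMutualInfo R := by
  obtain ⟨a, x, hx, hsum, hent, hform⟩ := exists_condEntropy_representation R hR hBC
  obtain ⟨b, y, hy, hsum', hent', hform'⟩ := exists_condEntropy_representation (ptraceB3 R) hAC
    (by rwa [ptraceA_ptraceB3])
  have h := neg_sum_mul_log_le_of_sum_div_add_le b y a x (fun i => Or.inl (hy i))
    (fun i => Or.inl (hx i)) (by rw [hsum, hsum', trace_ptraceB3]) (fun t ht => by
      obtain ⟨X, hX⟩ := (hform' t ht).1
      rw [← hX, ptraceA_ptraceB3, ← ptraceB3_one_kronecker, ← modularForm_midExt]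
      exact (hform t ht).2 ⟨_, rfl⟩)
  rw [hent, hent', ptraceA_ptraceB3] at h
  rw [condMutualInfo]
  linarith

theorem ptraceA_add_smul_one [Fintype A] [DecidableEq A] [DecidableEq C]
    (R : Matrix (A × C) (A × C) ℂ) (c : ℂ) :
    ptraceA (R + c • 1) = ptraceA R + (Fintype.card A * c) • (1 : Matrix C C ℂ) := by
  ext x y
  by_cases h : x = y <;>
  simp [ptraceA, Finset.sum_add_distrib, one_apply, h]

theorem ptraceB3_add_smul_one [DecidableEq A] [Fintype B] [DecidableEq B] [DecidableEq C]
    (R : Matrix (A × B × C) (A × B × C) ℂ) (c : ℂ) :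
    ptraceB3 (R + c • 1) = ptraceB3 R + (Fintype.card B * c) • (1 : Matrix (A × C) (A × C) ℂ) := by
  ext ⟨x, x'⟩ ⟨y, y'⟩
  by_cases h : x = y <;> by_cases h' : x' = y' <;>
  simp [ptraceB3, Finset.sum_add_distrib, one_apply, h, h']

theorem posSemidef_ptraceA [Fintype A] {R : Matrix (A × C) (A × C) ℂ} (hR : R.PosSemidef) :
    (ptraceA R).PosSemidef := by
  have : ptraceA R = ∑ a, R.submatrix (fun c => (a, c)) (fun c => (a, c)) := by
    ext x y
    simp [ptraceA, Matrix.sum_apply]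
  rw [this]
  exact posSemidef_sum _ fun a _ => hR.submatrix _

theorem posSemidef_ptraceB3 [Fintype B] {R : Matrix (A × B × C) (A × B × C) ℂ} (hR : R.PosSemidef) :
    (ptraceB3 R).PosSemidef := by
  have : ptraceB3 R = ∑ b, R.submatrix (fun x => (x.1, b, x.2)) (fun x => (x.1, b, x.2)) := by
    ext x y
    simp [ptraceB3, Matrix.sum_apply]
  rw [this]
  exact posSemidef_sum _ fun a _ => hR.submatrix _

theorem posDef_add_smul_one {n : Type*} [Fintype n] [DecidableEq n] {M : Matrix n n ℂ}
    (hM : M.PosSemidef) {c : ℝ} (hc : 0 < c) : (M + (c : ℂ) • (1 : Matrix n n ℂ)).PosDef :=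
  (PosDef.one.smul (by exact_mod_cast hc : (0 : ℂ) < c)).posSemidef_add hM

/-- Strong subadditivity. -/
theorem condMutualInfo_nonneg [Fintype A] [DecidableEq A] [Fintype B] [DecidableEq B] [Fintype C]
    [DecidableEq C] [Nonempty A] [Nonempty B]
    (R : Matrix (A × B × C) (A × B × C) ℂ)
    (hR : R.PosSemidef) : 0 ≤ condMutualInfo R := by
  have hBC := posSemidef_ptraceA hR
  have hC := posSemidef_ptraceA hBC
  have hAC := posSemidef_ptraceB3 hR
  let f : ℝ → ℝ := fun ε => condMutualInfo (R + (ε : ℂ) • 1)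
  have e1 : ∀ ε : ℝ, ptraceB3 (R + (ε : ℂ) • 1) =
      ptraceB3 R + ((Fintype.card B * ε : ℝ) : ℂ) • 1 := fun ε => by
    rw [ptraceB3_add_smul_one]; push_cast; rfl
  have e2 : ∀ ε : ℝ, ptraceA (R + (ε : ℂ) • 1) =
      ptraceA R + ((Fintype.card A * ε : ℝ) : ℂ) • 1 := fun ε => by
    rw [ptraceA_add_smul_one]; push_cast; rfl
  have e3 : ∀ ε : ℝ, ptraceA (ptraceA (R + (ε : ℂ) • 1)) =
      ptraceA (ptraceA R) + ((Fintype.card B * (Fintype.card A * ε) : ℝ) : ℂ) • 1 := fun ε => by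
    rw [e2, ptraceA_add_smul_one]; push_cast; rfl
  have hA : (0 : ℝ) < Fintype.card A := by exact_mod_cast Fintype.card_pos
  have hB : (0 : ℝ) < Fintype.card B := by exact_mod_cast Fintype.card_pos
  have hcont : Continuous f := by
    simp only [f, condMutualInfo, e1, e3]
    simp only [e2]
    refine ((Continuous.add ?_ ?_).sub ?_).sub ?_
    · exact (continuous_vN_add_smul_one hAC.1).comp (continuous_const.mul continuous_id)
    · exact (continuous_vN_add_smul_one hBC.1).comp (continuous_const.mul continuous_id)
    · exact continuous_vN_add_smul_one hR.1
    · exact (continuous_vN_add_smul_one hC.1).comp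
        (continuous_const.mul (continuous_const.mul continuous_id))
  have hpos : ∀ ε : ℝ, 0 < ε → 0 ≤ f ε := by
    intro ε hε
    refine condMutualInfo_nonneg_of_posDef _ (posDef_add_smul_one hR hε) ?_ ?_ ?_
    · rw [e1]; exact posDef_add_smul_one hAC (by positivity)
    · rw [e2]; exact posDef_add_smul_one hBC (by positivity)
    · rw [e3]; exact posDef_add_smul_one hC (by positivity)
  have h0 : f 0 = condMutualInfo R := by simp [f]
  rw [← h0]
  refine ge_of_tendsto (hcont.continuousWithinAt (s := Set.Ioi 0) (x := 0)) ?_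
  filter_upwards [self_mem_nhdsWithin] with ε hε using hpos ε hε

end

section

variable {A B C : Type*}

theorem posSemidef_ptraceB [Fintype B] {R : Matrix (A × B) (A × B) ℂ} (hR : R.PosSemidef) :
    (ptraceB R).PosSemidef := by
  have : ptraceB R = ∑ b, R.submatrix (fun a => (a, b)) (fun a => (a, b)) := by
    ext x y
    simp [ptraceB, Matrix.sum_apply]
  rw [this]
  exact posSemidef_sum _ fun b _ => hR.submatrix _

theorem posSemidef_ptraceC3 [Fintype C] {R : Matrix (A × B × C) (A × B × C) ℂ}
    (hR : R.PosSemidef) : (ptraceC3 R).PosSemidef := by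
  have : ptraceC3 R = ∑ c, R.submatrix (fun x => (x.1, x.2, c)) (fun x => (x.1, x.2, c)) := by
    ext x y
    simp [ptraceC3, Matrix.sum_apply]
  rw [this]
  exact posSemidef_sum _ fun c _ => hR.submatrix _

theorem trace_ptraceB [Fintype A] [Fintype B] (R : Matrix (A × B) (A × B) ℂ) :
    (ptraceB R).trace = R.trace := by
  simp only [ptraceB, trace, diag_apply, of_apply, Fintype.sum_prod_type]

theorem trace_ptraceA [Fintype A] [Fintype B] (R : Matrix (A × B) (A × B) ℂ) :
    (ptraceA R).trace = R.trace := by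
  simp only [ptraceA, trace, diag_apply, of_apply, Fintype.sum_prod_type]
  exact Finset.sum_comm

theorem exists_eq_mul_conjTranspose {n : Type*} [Fintype n] [DecidableEq n]
    {M : Matrix n n ℂ} (hM : M.PosSemidef) : ∃ N : Matrix n n ℂ, M = N * Nᴴ := by
  obtain ⟨U, -, -, h⟩ := exists_unitary_diagonalization hM.1
  refine ⟨U * diagonal fun i => ((Real.sqrt (hM.1.eigenvalues i) : ℝ) : ℂ), ?_⟩
  conv_lhs => rw [h]
  rw [conjTranspose_mul, diagonal_conjTranspose, mul_assoc, mul_assoc, ← mul_assoc (diagonal _)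
    (diagonal _), diagonal_mul_diagonal]
  congr 4
  ext i
  simp only [Pi.star_apply, Complex.star_def, Complex.conj_ofReal, ← Complex.ofReal_mul,
    Real.mul_self_sqrt (hM.eigenvalues_nonneg i)]

variable [Fintype A] [DecidableEq A] [Fintype B] [DecidableEq B] [Fintype C] [DecidableEq C]

/-- Strong subadditivity in the form `S(ABC) + S(A) ≤ S(AC) + S(AB)`. -/
theorem vN_add_vN_le_of_shared_first [Nonempty B] [Nonempty C]
    {R : Matrix (A × B × C) (A × B × C) ℂ} (hR : R.PosSemidef) :
    vN R + vN (ptraceB (ptraceC3 R)) ≤ vN (ptraceB3 R) + vN (ptraceC3 R) := by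
  let e : C × B × A ≃ A × B × C :=
    ⟨fun x => (x.2.2, x.2.1, x.1), fun x => (x.2.2, x.2.1, x.1), fun _ => rfl, fun _ => rfl⟩
  have h := condMutualInfo_nonneg (R.submatrix e e) (hR.submatrix e)
  have h1 : ptraceB3 (R.submatrix e e) =
      (ptraceB3 R).submatrix (Equiv.prodComm C A) (Equiv.prodComm C A) := rfl
  have h2 : ptraceA (R.submatrix e e) =
      (ptraceC3 R).submatrix (Equiv.prodComm B A) (Equiv.prodComm B A) := rfl
  have h3 : ptraceA ((ptraceC3 R).submatrix (Equiv.prodComm B A) (Equiv.prodComm B A)) =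
      ptraceB (ptraceC3 R) := rfl
  rw [condMutualInfo, h1, h2, h3, vN_submatrix_equiv hR.1,
    vN_submatrix_equiv (posSemidef_ptraceB3 hR).1,
    vN_submatrix_equiv (posSemidef_ptraceC3 hR).1] at h
  linarith

/-- Weak monotonicity: `S(A) + S(C) ≤ S(AB) + S(BC)`. -/
theorem vN_add_vN_le_of_shared_middle [Nonempty A] [Nonempty B] [Nonempty C]
    {R : Matrix (A × B × C) (A × B × C) ℂ} (hR : R.PosSemidef) :
    vN (ptraceB (ptraceC3 R)) + vN (ptraceA (ptraceA R)) ≤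
      vN (ptraceC3 R) + vN (ptraceA R) := by
  obtain ⟨M, hM⟩ := exists_eq_mul_conjTranspose hR
  let N : Matrix ((A × B × C) × B × A) C ℂ := of fun x c => M (x.2.2, x.2.1, c) x.1
  let N' : Matrix ((A × B × C) × A) (B × C) ℂ := of fun x y => M (x.2, y.1, y.2) x.1
  have hRe : ∀ x y, R x y = ∑ d, M x d * star (M y d) := fun x y => by
    rw [hM]; simp [mul_apply]
  have h := condMutualInfo_nonneg (N * Nᴴ) (posSemidef_self_mul_conjTranspose N)
  have h0 : Nᴴ * N = (ptraceA (ptraceA R))ᵀ := by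
    ext c c'
    simp only [N, mul_apply, conjTranspose_apply, of_apply, transpose_apply, ptraceA, hRe,
      Fintype.sum_prod_type (α₁ := A × B × C), Fintype.sum_prod_type (α₁ := B) (α₂ := A)]
    rw [Finset.sum_comm]
    refine Finset.sum_congr rfl fun b _ => ?_
    rw [Finset.sum_comm]
    exact Finset.sum_congr rfl fun a _ => Finset.sum_congr rfl fun d _ => mul_comm _ _
  have h1 : ptraceA (N * Nᴴ) =
      (ptraceC3 R).submatrix (Equiv.prodComm B A) (Equiv.prodComm B A) := by
    ext x y
    simp only [N, mul_apply, conjTranspose_apply, of_apply, ptraceA, ptraceC3, hRe,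
      submatrix_apply, Equiv.prodComm_apply, Prod.fst_swap, Prod.snd_swap]
    exact Finset.sum_comm
  have h2 : ptraceA ((ptraceC3 R).submatrix (Equiv.prodComm B A) (Equiv.prodComm B A)) =
      ptraceB (ptraceC3 R) := rfl
  have h3 : ptraceB3 (N * Nᴴ) = N' * N'ᴴ := by
    ext x y
    simp only [N, N', mul_apply, conjTranspose_apply, of_apply, ptraceB3,
      Fintype.sum_prod_type (α₁ := B) (α₂ := C)]
  have h4 : N'ᴴ * N' = (ptraceA R)ᵀ := by
    ext x y
    simp only [N', mul_apply, conjTranspose_apply, of_apply, transpose_apply, ptraceA, hRe,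
      Fintype.sum_prod_type (α₁ := A × B × C)]
    rw [Finset.sum_comm]
    exact Finset.sum_congr rfl fun a _ => Finset.sum_congr rfl fun d _ => mul_comm _ _
  rw [condMutualInfo, h1, h2, h3, vN_mul_conjTranspose_self, vN_mul_conjTranspose_self, h0, h4,
    vN_transpose (posSemidef_ptraceA hR).1,
    vN_transpose (posSemidef_ptraceA (posSemidef_ptraceA hR)).1,
    vN_submatrix_equiv (posSemidef_ptraceC3 hR).1] at h
  linarith

variable [Nonempty A] [Nonempty B] [Nonempty C]

/-- The coherent information bounds half the conditional mutual information of any extension. -/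
theorem vN_ptraceB_sub_vN_le {R : Matrix (A × B × C) (A × B × C) ℂ} (hR : R.PosSemidef) :
    vN (ptraceB (ptraceC3 R)) - vN (ptraceC3 R) ≤ (1 / 2) * condMutualInfo R := by
  have h1 := vN_add_vN_le_of_shared_first hR
  have h2 := vN_add_vN_le_of_shared_middle hR
  rw [condMutualInfo]
  linarith

theorem vN_ptraceA_sub_vN_le {R : Matrix (A × B × C) (A × B × C) ℂ} (hR : R.PosSemidef) :
    vN (ptraceA (ptraceC3 R)) - vN (ptraceC3 R) ≤ (1 / 2) * condMutualInfo R := by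
  let e : B × A × C ≃ A × B × C :=
    ⟨fun x => (x.2.1, x.1, x.2.2), fun x => (x.2.1, x.1, x.2.2), fun _ => rfl, fun _ => rfl⟩
  have h := vN_ptraceB_sub_vN_le (hR.submatrix e)
  have h1 : ptraceB3 (R.submatrix e e) = ptraceA R := rfl
  have h2 : ptraceA (R.submatrix e e) = ptraceB3 R := rfl
  have h3 : ptraceC3 (R.submatrix e e) =
      (ptraceC3 R).submatrix (Equiv.prodComm B A) (Equiv.prodComm B A) := rfl
  have h4 : ptraceB ((ptraceC3 R).submatrix (Equiv.prodComm B A) (Equiv.prodComm B A)) =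
      ptraceA (ptraceC3 R) := rfl
  rw [condMutualInfo, h1, h2, h3, h4, ptraceA_ptraceB3, vN_submatrix_equiv hR.1,
    vN_submatrix_equiv (posSemidef_ptraceC3 hR).1] at h
  rw [condMutualInfo]
  linarith

end

theorem sum_eigenvalues_eq_one {n : Type*} [Fintype n] [DecidableEq n] {M : Matrix n n ℂ}
    (hM : M.IsHermitian) (htr : M.trace = 1) : ∑ i, hM.eigenvalues i = 1 := by
  have h := hM.trace_eq_sum_eigenvalues
  rw [htr] at h
  apply Complex.ofReal_injective
  push_cast
  exact h.symm

theorem sum_eigenvalues_sq_eq {n : Type*} [Fintype n] [DecidableEq n] {M : Matrix n n ℂ}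
    (hM : M.IsHermitian) {P : ℝ} (hP : (M * M).trace = (P : ℂ)) :
    ∑ i, hM.eigenvalues i ^ 2 = P := by
  obtain ⟨U, hU, -, h⟩ := exists_unitary_diagonalization hM
  have h1 : (M * M).trace = ∑ i, (hM.eigenvalues i : ℂ) ^ 2 := by
    set D := diagonal fun i => (hM.eigenvalues i : ℂ) with hD
    have h2 : M * M = U * (D * D) * Uᴴ := by
      calc M * M = (U * D * Uᴴ) * (U * D * Uᴴ) := by rw [← h]
        _ = U * D * (Uᴴ * U) * D * Uᴴ := by simp only [mul_assoc]
        _ = U * (D * D) * Uᴴ := by rw [hU]; simp only [mul_assoc, mul_one]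
    rw [h2, trace_mul_comm, ← mul_assoc, hU, one_mul, hD, diagonal_mul_diagonal, trace_diagonal]
    exact Finset.sum_congr rfl fun i _ => (sq _).symm
  rw [h1] at hP
  exact_mod_cast hP

theorem Lent_le_vN {n : Type*} [Fintype n] [DecidableEq n] {M : Matrix n n ℂ}
    (hM : M.PosSemidef) (htr : M.trace = 1) {P : ℝ} (hP : (M * M).trace = (P : ℂ)) {k : ℕ}
    (hk : 2 ≤ k) (hk1 : 1 / (k : ℝ) ≤ P) (hk2 : P ≤ 1 / ((k : ℝ) - 1)) : Lent P k ≤ vN M := by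
  rw [vN, dif_pos hM.1]
  exact Lent_le_entropy _ hM.eigenvalues_nonneg (sum_eigenvalues_eq_one hM.1 htr) P
    (sum_eigenvalues_sq_eq hM.1 hP) k hk hk1 hk2

theorem vN_le_Uent {n : Type*} [Fintype n] [DecidableEq n] {M : Matrix n n ℂ}
    (hM : M.PosSemidef) (htr : M.trace = 1) {P : ℝ} (hP : (M * M).trace = (P : ℂ)) {d : ℕ}
    (hd : 2 ≤ d) (hcard : Fintype.card n = d) : vN M ≤ Uent P d := by
  rw [vN, dif_pos hM.1]
  exact entropy_le_Uent d hd hcard _ hM.eigenvalues_nonneg (sum_eigenvalues_eq_one hM.1 htr) P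
    (sum_eigenvalues_sq_eq hM.1 hP)

end

/-- Theorem 1: for any density matrix `ρ_AB` with marginal purities
`P_A, P_B` and global purity `P_AB`,
`E_sq(ρ_AB) ≥ max{max{L(P_A), L(P_B)} − U(P_AB, d_A d_B), 0}`. -/
theorem squashed_entanglement_purity_lower_bound
    (dA dB : ℕ) (hdA : 2 ≤ dA) (hdB : 2 ≤ dB)
    (ρAB : Matrix (Fin dA × Fin dB) (Fin dA × Fin dB) ℂ)
    (hρ : ρAB.PosSemidef) (htr : ρAB.trace = 1)
    (PA PB PAB : ℝ)
    (hPA : (ptraceB ρAB * ptraceB ρAB).trace = (PA : ℂ))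
    (hPB : (ptraceA ρAB * ptraceA ρAB).trace = (PB : ℂ))
    (hPAB : (ρAB * ρAB).trace = (PAB : ℂ))
    (kA : ℕ) (hkA : 2 ≤ kA) (hkA1 : 1 / (kA : ℝ) ≤ PA) (hkA2 : PA ≤ 1 / ((kA : ℝ) - 1))
    (kB : ℕ) (hkB : 2 ≤ kB) (hkB1 : 1 / (kB : ℝ) ≤ PB) (hkB2 : PB ≤ 1 / ((kB : ℝ) - 1)) :
    Esq ρAB ≥ max (max (Lent PA kA) (Lent PB kB) - Uent PAB (dA * dB)) 0 := by
  have : Nonempty (Fin dA) := ⟨⟨0, by omega⟩⟩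
  have : Nonempty (Fin dB) := ⟨⟨0, by omega⟩⟩
  have hU := vN_le_Uent hρ htr hPAB (d := dA * dB) (by nlinarith) (by simp)
  have hLA := Lent_le_vN (posSemidef_ptraceB hρ) ((trace_ptraceB _).trans htr) hPA hkA hkA1 hkA2
  have hLB := Lent_le_vN (posSemidef_ptraceA hρ) ((trace_ptraceA _).trans htr) hPB hkB hkB1 hkB2
  refine le_csInf ?_ ?_
  · let f : Fin dA × Fin dB × Fin 1 → Fin dA × Fin dB := fun x => (x.1, x.2.1)
    refine ⟨_, 1, le_rfl, ρAB.submatrix f f, hρ.submatrix f, ?_, ?_, rfl⟩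
    · rw [← htr]
      simp [f, Matrix.trace, Fintype.sum_prod_type]
    · ext x y
      simp [f, ptraceC3]
  · rintro x ⟨dC, hdC, R, hR, -, rfl, rfl⟩
    have : Nonempty (Fin dC) := ⟨⟨0, by omega⟩⟩
    have hA := vN_ptraceB_sub_vN_le hR
    have hB := vN_ptraceA_sub_vN_le hR
    have h0 := condMutualInfo_nonneg R hR
    refine max_le ?_ (by linarith)
    rw [sub_le_iff_le_add]
    exact max_le (by linarith) (by linarith)
end

section
/- Let ρ_AB be a density matrix on ℂ^{d_A} ⊗ ℂ^{d_B} and let M_A, M_B be Hermitian matrices on ℂ^{d_A} and ℂ^{d_B} respectively with nonzero operator norm. Define the correlation function C(M_A, M_B) = Tr[ρ_AB (M_A ⊗ M_B)] − Tr[ρ_AB (M_A ⊗ I)]·Tr[ρ_AB (I ⊗ M_B)]. Then the mutual information satisfies I(A:B) ≥ C(M_A, M_B)² / (2 ‖M_A‖² ‖M_B‖²), where ‖·‖ denotes the operator norm. -/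
open scoped Kronecker ComplexOrder

/-- Mutual information `I(A:B) = S(ρ_A) + S(ρ_B) − S(ρ_AB)`. -/
noncomputable def mutualInfo {A B : Type*} [Fintype A] [DecidableEq A] [Fintype B] [DecidableEq B]
    (ρ : Matrix (A × B) (A × B) ℂ) : ℝ :=
  vN (ptraceB ρ) + vN (ptraceA ρ) - vN ρ

/-- Operator (ℓ² → ℓ²) norm of a matrix. -/
noncomputable def opNorm {n : Type*} [Fintype n] [DecidableEq n] (M : Matrix n n ℂ) : ℝ :=
  ‖Matrix.toEuclideanCLM (𝕜 := ℂ) M‖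

open scoped Matrix.Norms.L2Operator

/-! ### A quadratic lower bound on the scalar relative entropy -/

lemma rational_le_log {x : ℝ} (hx : 0 < x) :
    (x - 1) * (5 * x + 1) / (2 * x * (x + 2)) ≤ Real.log x := by
  set g : ℝ → ℝ := fun y => Real.log y - (y - 1) * (5 * y + 1) / (2 * y * (y + 2)) with hg
  have hderiv : ∀ y : ℝ, 0 < y → HasDerivAt g ((y - 1) ^ 3 / (y ^ 2 * (y + 2) ^ 2)) y := by
    intro y hy
    have hid := hasDerivAt_id' y
    have hnum := (hid.sub_const 1).mul ((hid.const_mul 5).add_const 1)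
    have hden := (hid.const_mul 2).mul (hid.add_const 2)
    have h := (Real.hasDerivAt_log hy.ne').sub (hnum.div hden (by simp; constructor <;> linarith))
    refine h.congr_deriv ?_
    simp only [Pi.mul_apply]
    field_simp
    ring
  have hcont : ∀ s ⊆ Set.Ioi (0 : ℝ), ContinuousOn g s := fun s hs y hy =>
    (hderiv y (hs hy)).continuousAt.continuousWithinAt
  have hone : g 1 = 0 := by simp [hg]
  have hnonneg : 0 ≤ g x := by
    rcases le_total x 1 with h | h
    · have hanti : AntitoneOn g (Set.Icc x 1) := by
        refine antitoneOn_of_deriv_nonpos (convex_Icc x 1)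
          (hcont _ fun y hy => hx.trans_le hy.1) ?_ ?_ <;> rw [interior_Icc] <;> intro y hy
        · exact (hderiv y (hx.trans hy.1)).differentiableAt.differentiableWithinAt
        · rw [(hderiv y (hx.trans hy.1)).deriv]
          refine div_nonpos_of_nonpos_of_nonneg ?_ (by positivity)
          exact (Odd.pow_nonpos_iff (by decide)).2 (by linarith [hy.2])
      rw [← hone]
      exact hanti ⟨le_rfl, h⟩ ⟨h, le_rfl⟩ h
    · have hmono : MonotoneOn g (Set.Icc 1 x) := by
        refine monotoneOn_of_deriv_nonneg (convex_Icc 1 x)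
          (hcont _ fun y hy => one_pos.trans_le hy.1) ?_ ?_ <;> rw [interior_Icc] <;> intro y hy
        · exact (hderiv y (one_pos.trans hy.1)).differentiableAt.differentiableWithinAt
        · rw [(hderiv y (one_pos.trans hy.1)).deriv]
          have : 0 ≤ y - 1 := by linarith [hy.1]
          positivity
      rw [← hone]
      exact hmono ⟨le_rfl, h⟩ ⟨h, le_rfl⟩ h
  simpa [hg] using hnonneg

lemma three_mul_sub_sq_le_relEntropy {x y : ℝ} (hx : 0 ≤ x) (hy : 0 ≤ y) (hxy : y = 0 → x = 0) :
    3 * (x - y) ^ 2 ≤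
      2 * (x * Real.log x - x * Real.log y - x + y) * (x + 2 * y) := by
  rcases hy.eq_or_lt with rfl | hy
  · simp [hxy rfl]
  rcases hx.eq_or_lt with rfl | hx
  · simp; nlinarith
  have h := rational_le_log (div_pos hx hy)
  rw [Real.log_div hx.ne' hy.ne'] at h
  have h' : (x / y - 1) * (5 * (x / y) + 1) / (2 * (x / y) * (x / y + 2))
      = (x - y) * (5 * x + y) / (2 * x * (x + 2 * y)) := by
    field_simp
  rw [h', div_le_iff₀ (by positivity)] at h
  nlinarith

/-! ### Row and column sums controlled by the operator norm -/

section OperatorNorm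

variable {n A B : Type*} [Fintype n] [DecidableEq n] [Fintype A] [DecidableEq A]
  [Fintype B] [DecidableEq B]

lemma sum_col_norm_sq_le (N : Matrix n n ℂ) (i : n) : ∑ j, ‖N j i‖ ^ 2 ≤ ‖N‖ ^ 2 := by
  have h := N.l2_opNorm_mulVec (EuclideanSpace.single i 1)
  have h2 := pow_le_pow_left₀ (norm_nonneg _) h 2
  simpa [EuclideanSpace.norm_sq_eq] using h2

lemma sum_row_norm_sq_le (N : Matrix n n ℂ) (j : n) : ∑ i, ‖N j i‖ ^ 2 ≤ ‖N‖ ^ 2 := by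
  simpa [Matrix.conjTranspose_apply, Matrix.l2_opNorm_conjTranspose] using
    sum_col_norm_sq_le N.conjTranspose j

/-- Ampliation `X ↦ X ⊗ 1` as a star-algebra homomorphism. -/
noncomputable def kroneckerOneHom : Matrix A A ℂ →⋆ₐ[ℂ] Matrix (A × B) (A × B) ℂ where
  toFun X := X ⊗ₖ (1 : Matrix B B ℂ)
  map_one' := Matrix.one_kronecker_one
  map_mul' X Y := by rw [← Matrix.mul_kronecker_mul, one_mul]
  map_zero' := Matrix.zero_kronecker _
  map_add' X Y := Matrix.add_kronecker _ _ _
  commutes' r := by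
    simp [Algebra.algebraMap_eq_smul_one, Matrix.smul_kronecker]
  map_star' X := by
    simp [Matrix.star_eq_conjTranspose, Matrix.conjTranspose_kronecker]

/-- Ampliation `Y ↦ 1 ⊗ Y` as a star-algebra homomorphism. -/
noncomputable def oneKroneckerHom : Matrix B B ℂ →⋆ₐ[ℂ] Matrix (A × B) (A × B) ℂ where
  toFun Y := (1 : Matrix A A ℂ) ⊗ₖ Y
  map_one' := Matrix.one_kronecker_one
  map_mul' X Y := by rw [← Matrix.mul_kronecker_mul, one_mul]
  map_zero' := Matrix.kronecker_zero _
  map_add' X Y := Matrix.kronecker_add _ _ _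
  commutes' r := by
    simp [Algebra.algebraMap_eq_smul_one, Matrix.kronecker_smul]
  map_star' X := by
    simp [Matrix.star_eq_conjTranspose, Matrix.conjTranspose_kronecker]

lemma norm_kronecker_le (X : Matrix A A ℂ) (Y : Matrix B B ℂ) : ‖X ⊗ₖ Y‖ ≤ ‖X‖ * ‖Y‖ := by
  have hX : ‖X ⊗ₖ (1 : Matrix B B ℂ)‖ ≤ ‖X‖ :=
    NonUnitalStarAlgHom.norm_apply_le (kroneckerOneHom (A := A) (B := B)) X
  have hY : ‖(1 : Matrix A A ℂ) ⊗ₖ Y‖ ≤ ‖Y‖ :=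
    NonUnitalStarAlgHom.norm_apply_le (oneKroneckerHom (A := A) (B := B)) Y
  calc ‖X ⊗ₖ Y‖ = ‖(X ⊗ₖ (1 : Matrix B B ℂ)) * ((1 : Matrix A A ℂ) ⊗ₖ Y)‖ := by
        rw [← Matrix.mul_kronecker_mul, one_mul, mul_one]
    _ ≤ ‖X ⊗ₖ (1 : Matrix B B ℂ)‖ * ‖(1 : Matrix A A ℂ) ⊗ₖ Y‖ := norm_mul_le _ _
    _ ≤ ‖X‖ * ‖Y‖ := mul_le_mul hX hY (norm_nonneg _) (norm_nonneg _)

end OperatorNorm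

/-! ### A Pinsker-type inequality in a pair of eigenbases -/

section Pinsker

variable {n : Type*} [Fintype n] [DecidableEq n]

lemma sum_norm_sq_row_of_unitary {W : Matrix n n ℂ} (hW : W ∈ Matrix.unitaryGroup n ℂ) (i : n) :
    ∑ j, ‖W i j‖ ^ 2 = 1 := by
  have h := congrFun (congrFun (Matrix.mem_unitaryGroup_iff.1 hW) i) i
  simp only [Matrix.mul_apply, Matrix.star_apply, Matrix.one_apply_eq, RCLike.star_def,
    Complex.mul_conj, Complex.normSq_eq_norm_sq] at h
  exact_mod_cast h

lemma sum_norm_sq_col_of_unitary {W : Matrix n n ℂ} (hW : W ∈ Matrix.unitaryGroup n ℂ) (j : n) :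
    ∑ i, ‖W i j‖ ^ 2 = 1 := by
  simpa [Matrix.star_apply] using sum_norm_sq_row_of_unitary (Unitary.star_mem hW) j

lemma norm_sq_sum_le_relEntropy {W N : Matrix n n ℂ} (hW : W ∈ Matrix.unitaryGroup n ℂ)
    {p q : n → ℝ} (hp : ∀ i, 0 ≤ p i) (hq : ∀ j, 0 ≤ q j)
    (hp1 : ∑ i, p i = 1) (hq1 : ∑ j, q j = 1) {K : ℝ} (hK : ‖N‖ ≤ K)
    (hsupp : ∀ i j, q j = 0 → ‖W i j‖ ^ 2 * p i = 0) :
    ‖∑ i, ∑ j, ((p i - q j : ℝ) : ℂ) * W i j * N j i‖ ^ 2 ≤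
      2 * K ^ 2 *
        ∑ i, ∑ j, ‖W i j‖ ^ 2 * (p i * Real.log (p i) - p i * Real.log (q j)) := by
  set r : n × n → ℝ := fun x => |p x.1 - q x.2| * ‖W x.1 x.2‖ * ‖N x.2 x.1‖ with hr
  set f : n × n → ℝ := fun x => ‖W x.1 x.2‖ ^ 2 *
    (p x.1 * Real.log (p x.1) - p x.1 * Real.log (q x.2) - p x.1 + q x.2) with hf
  set g : n × n → ℝ := fun x => 2 / 3 * (‖N x.2 x.1‖ ^ 2 * (p x.1 + 2 * q x.2)) with hg
  have hscalar : ∀ x : n × n, W x.1 x.2 ≠ 0 → 3 * (p x.1 - q x.2) ^ 2 ≤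
      2 * (p x.1 * Real.log (p x.1) - p x.1 * Real.log (q x.2) - p x.1 + q x.2)
        * (p x.1 + 2 * q x.2) := fun x hx =>
    three_mul_sub_sq_le_relEntropy (hp _) (hq _) fun h0 => by
      simpa [hx] using hsupp x.1 x.2 h0
  have hf0 : ∀ x, 0 ≤ f x := by
    intro x
    by_cases hx : W x.1 x.2 = 0
    · simp [hf, hx]
    refine mul_nonneg (by positivity) ?_
    have hs := hscalar x hx
    rcases (add_nonneg (hp x.1) (mul_nonneg zero_le_two (hq x.2))).eq_or_lt with h0 | h0
    · have h1 : p x.1 = 0 := by linarith [hp x.1, hq x.2]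
      have h2 : q x.2 = 0 := by linarith [hp x.1, hq x.2]
      simp [h1, h2]
    · have := nonneg_of_mul_nonneg_left ((by positivity : (0 : ℝ) ≤ _).trans hs) h0
      linarith
  have hg0 : ∀ x, 0 ≤ g x := fun x => by
    have := hp x.1
    have := hq x.2
    positivity
  have hrfg : ∀ x, r x ^ 2 ≤ f x * g x := by
    intro x
    by_cases hx : W x.1 x.2 = 0
    · simp [hr, hf, hx]
    have hs := mul_le_mul_of_nonneg_left (hscalar x hx)
      (by positivity : 0 ≤ ‖W x.1 x.2‖ ^ 2 * ‖N x.2 x.1‖ ^ 2 / 3)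
    simp only [hr, hf, hg, mul_pow, sq_abs]
    linarith
  have hcs := Finset.sum_sq_le_sum_mul_sum_of_sq_le_mul Finset.univ
    (fun x _ => hf0 x) (fun x _ => hg0 x) (fun x _ => hrfg x)
  have hnorm : ‖∑ i, ∑ j, ((p i - q j : ℝ) : ℂ) * W i j * N j i‖ ≤ ∑ x, r x := by
    rw [← Fintype.sum_prod_type' (fun i j => ((p i - q j : ℝ) : ℂ) * W i j * N j i)]
    refine (norm_sum_le _ _).trans_eq (Finset.sum_congr rfl fun x _ => ?_)
    rw [norm_mul, norm_mul, Complex.norm_real, Real.norm_eq_abs]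
  have hfsum : ∑ x, f x =
      ∑ i, ∑ j, ‖W i j‖ ^ 2 * (p i * Real.log (p i) - p i * Real.log (q j)) := by
    have h1 : ∑ i, ∑ j, ‖W i j‖ ^ 2 * p i = 1 := by
      simp_rw [← Finset.sum_mul, sum_norm_sq_row_of_unitary hW, one_mul, hp1]
    have h2 : ∑ i, ∑ j, ‖W i j‖ ^ 2 * q j = 1 := by
      rw [Finset.sum_comm]
      simp_rw [← Finset.sum_mul, sum_norm_sq_col_of_unitary hW, one_mul, hq1]
    rw [Fintype.sum_prod_type]
    simp only [hf, mul_add, mul_sub, Finset.sum_add_distrib, Finset.sum_sub_distrib] at h1 h2 ⊢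
    linarith
  have hgsum : ∑ x, g x ≤ 2 * K ^ 2 := by
    have hK2 := pow_le_pow_left₀ (norm_nonneg _) hK 2
    have h1 : ∑ i, ∑ j, ‖N j i‖ ^ 2 * p i ≤ ‖N‖ ^ 2 := by
      simp_rw [← Finset.sum_mul]
      calc _ ≤ ∑ i, ‖N‖ ^ 2 * p i := Finset.sum_le_sum fun i _ =>
            mul_le_mul_of_nonneg_right (sum_col_norm_sq_le N i) (hp i)
        _ = ‖N‖ ^ 2 := by rw [← Finset.mul_sum, hp1, mul_one]
    have h2 : ∑ i, ∑ j, ‖N j i‖ ^ 2 * q j ≤ ‖N‖ ^ 2 := by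
      rw [Finset.sum_comm]
      simp_rw [← Finset.sum_mul]
      calc _ ≤ ∑ j, ‖N‖ ^ 2 * q j := Finset.sum_le_sum fun j _ =>
            mul_le_mul_of_nonneg_right (sum_row_norm_sq_le N j) (hq j)
        _ = ‖N‖ ^ 2 := by rw [← Finset.mul_sum, hq1, mul_one]
    rw [← Finset.mul_sum, Fintype.sum_prod_type]
    simp only [mul_add, mul_left_comm _ (2 : ℝ), Finset.sum_add_distrib, ← Finset.mul_sum]
    linarith
  calc _ ≤ (∑ x, r x) ^ 2 := pow_le_pow_left₀ (norm_nonneg _) hnorm 2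
    _ ≤ (∑ x, f x) * ∑ x, g x := hcs
    _ ≤ (∑ x, f x) * (2 * K ^ 2) :=
        mul_le_mul_of_nonneg_left hgsum (Finset.sum_nonneg fun x _ => hf0 x)
    _ = _ := by rw [hfsum, mul_comm]

lemma trace_sub_conj_diagonal_mul {U V : Matrix n n ℂ} (hU : U ∈ Matrix.unitaryGroup n ℂ)
    (hV : V ∈ Matrix.unitaryGroup n ℂ) (p q : n → ℝ) (M : Matrix n n ℂ) :
    (U * Matrix.diagonal (fun i => (p i : ℂ)) * star U * M).trace
        - (V * Matrix.diagonal (fun i => (q i : ℂ)) * star V * M).trace =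
      ∑ i, ∑ j, ((p i - q j : ℝ) : ℂ) * (star U * V) i j * (star V * M * U) j i := by
  have hU' := Matrix.mem_unitaryGroup_iff.1 hU
  have hV' := Matrix.mem_unitaryGroup_iff.1 hV
  have h1 : (U * Matrix.diagonal (fun i => (p i : ℂ)) * star U * M).trace =
      (Matrix.diagonal (fun i => (p i : ℂ)) * ((star U * V) * (star V * M * U))).trace := by
    rw [show (star U * V) * (star V * M * U) = star U * (V * star V) * M * U by
        simp only [mul_assoc], hV', mul_one, mul_assoc U, mul_assoc U, Matrix.trace_mul_comm]
    simp only [mul_assoc]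
  have h2 : (V * Matrix.diagonal (fun i => (q i : ℂ)) * star V * M).trace =
      ((star U * V) * (Matrix.diagonal (fun i => (q i : ℂ)) * (star V * M * U))).trace := by
    rw [Matrix.trace_mul_comm (star U * V),
      show Matrix.diagonal (fun i => (q i : ℂ)) * (star V * M * U) * (star U * V) =
        Matrix.diagonal (fun i => (q i : ℂ)) * star V * M * (U * star U) * V by
        simp only [mul_assoc], hU', mul_one, mul_assoc V, mul_assoc V, Matrix.trace_mul_comm]
  rw [h1, h2]
  simp only [Matrix.trace, Matrix.diag_apply, Matrix.diagonal_mul]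
  rw [← Finset.sum_sub_distrib]
  refine Finset.sum_congr rfl fun i _ => ?_
  rw [Matrix.mul_apply, Matrix.mul_apply, Finset.mul_sum, ← Finset.sum_sub_distrib]
  refine Finset.sum_congr rfl fun j _ => ?_
  rw [Matrix.diagonal_mul]
  push_cast
  ring

lemma star_mul_conj_diagonal_mul_apply {U V : Matrix n n ℂ} (p : n → ℝ) (j : n) :
    (star V * (U * Matrix.diagonal (fun i => (p i : ℂ)) * star U) * V) j j =
      ((∑ i, ‖(star U * V) i j‖ ^ 2 * p i : ℝ) : ℂ) := by
  have h : star V * (U * Matrix.diagonal (fun i => (p i : ℂ)) * star U) * V =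
      star (star U * V) * (Matrix.diagonal (fun i => (p i : ℂ)) * (star U * V)) := by
    simp only [star_mul, star_star, mul_assoc]
  rw [h, Matrix.mul_apply]
  push_cast
  refine Finset.sum_congr rfl fun i _ => ?_
  rw [Matrix.diagonal_mul, Matrix.star_apply, RCLike.star_def, mul_left_comm, Complex.conj_mul',
    mul_comm]

end Pinsker

/-! ### Partial traces -/

section PartialTrace

variable {A B : Type*}

lemma trace_mul_kronecker_one [Fintype A] [Fintype B] [DecidableEq B]
    (ρ : Matrix (A × B) (A × B) ℂ) (X : Matrix A A ℂ) :
    (ρ * (X ⊗ₖ (1 : Matrix B B ℂ))).trace = (ptraceB ρ * X).trace := by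
  simp only [Matrix.trace, Matrix.diag_apply, Matrix.mul_apply, Fintype.sum_prod_type,
    Matrix.kroneckerMap_apply, Matrix.one_apply, ptraceB, Matrix.of_apply, Finset.sum_mul]
  refine Finset.sum_congr rfl fun a _ => ?_
  rw [Finset.sum_comm]
  refine Finset.sum_congr rfl fun a' _ => Finset.sum_congr rfl fun b _ => ?_
  simp

lemma trace_mul_one_kronecker [Fintype A] [DecidableEq A] [Fintype B]
    (ρ : Matrix (A × B) (A × B) ℂ) (Y : Matrix B B ℂ) :
    (ρ * ((1 : Matrix A A ℂ) ⊗ₖ Y)).trace = (ptraceA ρ * Y).trace := by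
  simp only [Matrix.trace, Matrix.diag_apply, Matrix.mul_apply, Fintype.sum_prod_type,
    Matrix.kroneckerMap_apply, Matrix.one_apply, ptraceA, Matrix.of_apply, Finset.sum_mul]
  rw [Finset.sum_comm]
  refine Finset.sum_congr rfl fun b _ => ?_
  simp only [ite_mul, one_mul, zero_mul, mul_ite, mul_zero, Finset.sum_ite_irrel,
    Finset.sum_const_zero, Finset.sum_ite_eq', Finset.mem_univ, if_true]
  exact Finset.sum_comm

lemma Matrix.IsHermitian.ptraceB [Fintype B] {ρ : Matrix (A × B) (A × B) ℂ}
    (hρ : ρ.IsHermitian) :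
    (_root_.ptraceB ρ).IsHermitian := by
  ext a a'
  simp [_root_.ptraceB, hρ.apply]

lemma Matrix.IsHermitian.ptraceA [Fintype A] {ρ : Matrix (A × B) (A × B) ℂ}
    (hρ : ρ.IsHermitian) :
    (_root_.ptraceA ρ).IsHermitian := by
  ext a a'
  simp [_root_.ptraceA, hρ.apply]

variable [Fintype A] [DecidableEq A] [Fintype B] [DecidableEq B]

lemma sum_diag_star_kronecker_conj_snd (ρ : Matrix (A × B) (A × B) ℂ) (X : Matrix A A ℂ)
    {Y : Matrix B B ℂ} (hY : Y ∈ Matrix.unitaryGroup B ℂ) (a : A) :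
    ∑ b, (star (X ⊗ₖ Y) * ρ * (X ⊗ₖ Y)) (a, b) (a, b) = (star X * ptraceB ρ * X) a a := by
  have h1 : ∑ b, (star (X ⊗ₖ Y) * ρ * (X ⊗ₖ Y)) (a, b) (a, b) =
      (star (X ⊗ₖ Y) * ρ * (X ⊗ₖ Y) *
        (Matrix.single a a (1 : ℂ) ⊗ₖ (1 : Matrix B B ℂ))).trace := by
    rw [trace_mul_kronecker_one, Matrix.trace_mul_single]
    simp [ptraceB]
  have hYY : Y * star Y = 1 := Matrix.mem_unitaryGroup_iff.1 hY
  have h2 : (X ⊗ₖ Y) * (Matrix.single a a (1 : ℂ) ⊗ₖ (1 : Matrix B B ℂ)) * star (X ⊗ₖ Y) =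
      (X * Matrix.single a a (1 : ℂ) * star X) ⊗ₖ (1 : Matrix B B ℂ) := by
    rw [Matrix.star_eq_conjTranspose, Matrix.conjTranspose_kronecker, ← Matrix.mul_kronecker_mul,
      ← Matrix.mul_kronecker_mul, mul_one, ← Matrix.star_eq_conjTranspose,
      ← Matrix.star_eq_conjTranspose, hYY]
  rw [h1, mul_assoc, mul_assoc, Matrix.trace_mul_comm, mul_assoc, h2, trace_mul_kronecker_one,
    ← mul_assoc, Matrix.trace_mul_comm, ← mul_assoc, ← mul_assoc, Matrix.trace_mul_single]
  simp

lemma sum_diag_star_kronecker_conj_fst (ρ : Matrix (A × B) (A × B) ℂ) {X : Matrix A A ℂ}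
    (Y : Matrix B B ℂ) (hX : X ∈ Matrix.unitaryGroup A ℂ) (b : B) :
    ∑ a, (star (X ⊗ₖ Y) * ρ * (X ⊗ₖ Y)) (a, b) (a, b) = (star Y * ptraceA ρ * Y) b b := by
  have h1 : ∑ a, (star (X ⊗ₖ Y) * ρ * (X ⊗ₖ Y)) (a, b) (a, b) =
      (star (X ⊗ₖ Y) * ρ * (X ⊗ₖ Y) *
        ((1 : Matrix A A ℂ) ⊗ₖ Matrix.single b b (1 : ℂ))).trace := by
    rw [trace_mul_one_kronecker, Matrix.trace_mul_single]
    simp [ptraceA]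
  have hXX : X * star X = 1 := Matrix.mem_unitaryGroup_iff.1 hX
  have h2 : (X ⊗ₖ Y) * ((1 : Matrix A A ℂ) ⊗ₖ Matrix.single b b (1 : ℂ)) * star (X ⊗ₖ Y) =
      (1 : Matrix A A ℂ) ⊗ₖ (Y * Matrix.single b b (1 : ℂ) * star Y) := by
    rw [Matrix.star_eq_conjTranspose, Matrix.conjTranspose_kronecker, ← Matrix.mul_kronecker_mul,
      ← Matrix.mul_kronecker_mul, mul_one, ← Matrix.star_eq_conjTranspose,
      ← Matrix.star_eq_conjTranspose, hXX]
  rw [h1, mul_assoc, mul_assoc, Matrix.trace_mul_comm, mul_assoc, h2, trace_mul_one_kronecker,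
    ← mul_assoc, Matrix.trace_mul_comm, ← mul_assoc, ← mul_assoc, Matrix.trace_mul_single]
  simp

end PartialTrace

/-! ### Spectral decomposition and entropy -/

section Spectral

variable {n : Type*} [Fintype n] [DecidableEq n]

lemma Matrix.IsHermitian.eq_conj_diagonal {ρ : Matrix n n ℂ} (h : ρ.IsHermitian) :
    ρ = (h.eigenvectorUnitary : Matrix n n ℂ) *
      Matrix.diagonal (fun i => (h.eigenvalues i : ℂ)) *
        star (h.eigenvectorUnitary : Matrix n n ℂ) := by
  conv_lhs => rw [h.spectral_theorem, Unitary.conjStarAlgAut_apply]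
  rfl

lemma Matrix.IsHermitian.star_mul_mul_apply_self {ρ : Matrix n n ℂ} (h : ρ.IsHermitian) (i : n) :
    (star (h.eigenvectorUnitary : Matrix n n ℂ) * ρ * (h.eigenvectorUnitary : Matrix n n ℂ)) i i =
      (h.eigenvalues i : ℂ) := by
  have := h.conjStarAlgAut_star_eigenvectorUnitary
  rw [Unitary.conjStarAlgAut_star_apply] at this
  rw [this]
  simp

lemma vN_of_isHermitian {ρ : Matrix n n ℂ} (h : ρ.IsHermitian) :
    vN ρ = -∑ i, h.eigenvalues i * Real.log (h.eigenvalues i) := dif_pos h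

end Spectral

/-- The cross entropy of a joint distribution relative to the product of its marginals is the sum
of the marginal entropies (here with the opposite sign). -/
lemma sum_mul_log_mul_marginals {A B : Type*} [Fintype A] [Fintype B] {P : A × B → ℝ}
    {α : A → ℝ} {β : B → ℝ} (hP : ∀ x, 0 ≤ P x) (hα : ∀ a, ∑ b, P (a, b) = α a)
    (hβ : ∀ b, ∑ a, P (a, b) = β b) :
    ∑ x : A × B, P x * Real.log (α x.1 * β x.2) =
      ∑ a, α a * Real.log (α a) + ∑ b, β b * Real.log (β b) := by
  have hle1 : ∀ x : A × B, P x ≤ α x.1 := fun x => by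
    rw [← hα]
    exact Finset.single_le_sum (f := fun b => P (x.1, b)) (fun b _ => hP _) (Finset.mem_univ x.2)
  have hle2 : ∀ x : A × B, P x ≤ β x.2 := fun x => by
    rw [← hβ]
    exact Finset.single_le_sum (f := fun a => P (a, x.2)) (fun a _ => hP _) (Finset.mem_univ x.1)
  have h : ∀ x : A × B, P x * Real.log (α x.1 * β x.2) =
      P x * Real.log (α x.1) + P x * Real.log (β x.2) := by
    intro x
    rcases (hP x).eq_or_lt with h0 | h0
    · simp [← h0]
    · rw [Real.log_mul (h0.trans_le (hle1 x)).ne' (h0.trans_le (hle2 x)).ne', mul_add]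
  simp_rw [h, Finset.sum_add_distrib, Fintype.sum_prod_type]
  congr 1
  · simp_rw [← Finset.sum_mul, hα]
  · rw [Finset.sum_comm]
    simp_rw [← Finset.sum_mul, hβ]

lemma norm_sq_covariance_le_mutualInfo {A B : Type*} [Fintype A] [DecidableEq A] [Fintype B]
    [DecidableEq B] {ρ : Matrix (A × B) (A × B) ℂ} (hρ : ρ.PosSemidef) (htr : ρ.trace = 1)
    (M : Matrix (A × B) (A × B) ℂ) {K : ℝ} (hK : ‖M‖ ≤ K) :
    ‖(ρ * M).trace - ((ptraceB ρ ⊗ₖ ptraceA ρ) * M).trace‖ ^ 2 ≤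
      2 * K ^ 2 * mutualInfo ρ := by
  have hH := hρ.isHermitian
  have hA := hH.ptraceB
  have hB := hH.ptraceA
  set U : Matrix (A × B) (A × B) ℂ := (hH.eigenvectorUnitary : Matrix (A × B) (A × B) ℂ)
  set VA : Matrix A A ℂ := (hA.eigenvectorUnitary : Matrix A A ℂ)
  set VB : Matrix B B ℂ := (hB.eigenvectorUnitary : Matrix B B ℂ)
  set V : Matrix (A × B) (A × B) ℂ := VA ⊗ₖ VB with hVdef
  set p := hH.eigenvalues
  set α := hA.eigenvalues
  set β := hB.eigenvalues
  have hU : U ∈ Matrix.unitaryGroup (A × B) ℂ := hH.eigenvectorUnitary.2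
  have hVAu : VA ∈ Matrix.unitaryGroup A ℂ := hA.eigenvectorUnitary.2
  have hVBu : VB ∈ Matrix.unitaryGroup B ℂ := hB.eigenvectorUnitary.2
  have hV : V ∈ Matrix.unitaryGroup (A × B) ℂ := Matrix.kronecker_mem_unitary hVAu hVBu
  have hW : star U * V ∈ Matrix.unitaryGroup (A × B) ℂ := mul_mem (Unitary.star_mem hU) hV
  have hρeq : ρ = U * Matrix.diagonal (fun i => (p i : ℂ)) * star U := hH.eq_conj_diagonal
  have hσeq : ptraceB ρ ⊗ₖ ptraceA ρ =
      V * Matrix.diagonal (fun x : A × B => ((α x.1 * β x.2 : ℝ) : ℂ)) * star V := by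
    conv_lhs => rw [hA.eq_conj_diagonal, hB.eq_conj_diagonal]
    rw [Matrix.mul_kronecker_mul, Matrix.mul_kronecker_mul, Matrix.diagonal_kronecker_diagonal,
      hVdef, Matrix.star_eq_conjTranspose (VA ⊗ₖ VB), Matrix.conjTranspose_kronecker]
    simp only [Complex.ofReal_mul]
    rfl
  have hp0 : ∀ i, 0 ≤ p i := hρ.eigenvalues_nonneg
  set P : A × B → ℝ := fun x => ∑ i, ‖(star U * V) i x‖ ^ 2 * p i with hPdef
  have hterm : ∀ i x, 0 ≤ ‖(star U * V) i x‖ ^ 2 * p i := fun i x =>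
    mul_nonneg (by positivity) (hp0 i)
  have hP0 : ∀ x, 0 ≤ P x := fun x => Finset.sum_nonneg fun i _ => hterm i x
  have hPdiag : ∀ x, (star V * ρ * V) x x = (P x : ℂ) := fun x => by
    conv_lhs => rw [hρeq]
    exact star_mul_conj_diagonal_mul_apply p x
  have hPα : ∀ a, ∑ b, P (a, b) = α a := fun a => by
    have h := sum_diag_star_kronecker_conj_snd ρ VA hVBu a
    rw [hA.star_mul_mul_apply_self] at h
    simp_rw [← hVdef, hPdiag] at h
    exact_mod_cast h
  have hPβ : ∀ b, ∑ a, P (a, b) = β b := fun b => by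
    have h := sum_diag_star_kronecker_conj_fst ρ VB hVAu b
    rw [hB.star_mul_mul_apply_self] at h
    simp_rw [← hVdef, hPdiag] at h
    exact_mod_cast h
  have hα0 : ∀ a, 0 ≤ α a := fun a => hPα a ▸ Finset.sum_nonneg fun b _ => hP0 _
  have hβ0 : ∀ b, 0 ≤ β b := fun b => hPβ b ▸ Finset.sum_nonneg fun a _ => hP0 _
  have hp1 : ∑ i, p i = 1 := by
    have h : (1 : ℂ) = ∑ i, (p i : ℂ) := htr ▸ hH.trace_eq_sum_eigenvalues
    exact_mod_cast h.symm
  have hP1 : ∑ x, P x = 1 := by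
    rw [hPdef, Finset.sum_comm]
    simp_rw [← Finset.sum_mul, sum_norm_sq_row_of_unitary hW, one_mul, hp1]
  have hα1 : ∑ a, α a = 1 := by
    simp_rw [← hPα, ← Fintype.sum_prod_type, hP1]
  have hβ1 : ∑ b, β b = 1 := by
    simp_rw [← hPβ, ← Fintype.sum_prod_type_right, hP1]
  have hq1 : ∑ x : A × B, α x.1 * β x.2 = 1 := by
    rw [Fintype.sum_prod_type' (fun a b => α a * β b), ← Finset.sum_mul_sum, hα1, hβ1, one_mul]
  have hsupp : ∀ (i x : A × B), α x.1 * β x.2 = 0 → ‖(star U * V) i x‖ ^ 2 * p i = 0 := by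
    intro i x hx
    have hPx : P x = 0 := by
      rcases mul_eq_zero.1 hx with h | h
      · rw [← hPα] at h
        exact (Finset.sum_eq_zero_iff_of_nonneg fun b _ => hP0 _).1 h x.2 (Finset.mem_univ _)
      · rw [← hPβ] at h
        exact (Finset.sum_eq_zero_iff_of_nonneg fun a _ => hP0 _).1 h x.1 (Finset.mem_univ _)
    exact (Finset.sum_eq_zero_iff_of_nonneg fun i _ => hterm i x).1 hPx i (Finset.mem_univ _)
  have hN : ‖star V * M * U‖ = ‖M‖ := by
    rw [CStarRing.norm_mul_mem_unitary _ hU, CStarRing.norm_mem_unitary_mul _ (Unitary.star_mem hV)]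
  have hmain := norm_sq_sum_le_relEntropy (N := star V * M * U) hW hp0
    (fun x => mul_nonneg (hα0 x.1) (hβ0 x.2)) hp1 hq1 (hN.trans_le hK) hsupp
  rw [← trace_sub_conj_diagonal_mul hU hV, ← hρeq, ← hσeq] at hmain
  have hD : ∑ i, ∑ x : A × B, ‖(star U * V) i x‖ ^ 2 *
      (p i * Real.log (p i) - p i * Real.log (α x.1 * β x.2)) = mutualInfo ρ := by
    have h1 : ∑ i, ∑ x : A × B, ‖(star U * V) i x‖ ^ 2 * (p i * Real.log (p i)) =
        ∑ i, p i * Real.log (p i) := by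
      simp_rw [← Finset.sum_mul, sum_norm_sq_row_of_unitary hW, one_mul]
    have h2 : ∑ i, ∑ x : A × B, ‖(star U * V) i x‖ ^ 2 * (p i * Real.log (α x.1 * β x.2)) =
        ∑ x, P x * Real.log (α x.1 * β x.2) := by
      rw [Finset.sum_comm]
      simp_rw [hPdef, Finset.sum_mul, mul_assoc]
    simp_rw [mul_sub, Finset.sum_sub_distrib]
    rw [h1, h2, sum_mul_log_mul_marginals hP0 hPα hPβ, mutualInfo, vN_of_isHermitian hA,
      vN_of_isHermitian hB, vN_of_isHermitian hH]
    ring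
  rwa [hD] at hmain

/-- for any density matrix `ρ_AB` and Hermitian observables `M_A, M_B`
with nonzero operator norm, the mutual information satisfies
`I(A:B) ≥ C(M_A,M_B)² / (2 ‖M_A‖² ‖M_B‖²)`, where
`C(M_A,M_B) = Tr[ρ_AB (M_A ⊗ M_B)] − Tr[ρ_AB (M_A ⊗ I)] Tr[ρ_AB (I ⊗ M_B)]`. -/
theorem mutual_info_covariance_lower_bound
    (dA dB : ℕ)
    (ρAB : Matrix (Fin dA × Fin dB) (Fin dA × Fin dB) ℂ)
    (hρ : ρAB.PosSemidef) (htr : ρAB.trace = 1)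
    (MA : Matrix (Fin dA) (Fin dA) ℂ) (MB : Matrix (Fin dB) (Fin dB) ℂ)
    (hMA : MA.IsHermitian) (hMB : MB.IsHermitian)
    (hMAnorm : opNorm MA ≠ 0) (hMBnorm : opNorm MB ≠ 0)
    (Cval : ℝ)
    (hC : (Cval : ℂ) = (ρAB * (MA ⊗ₖ MB)).trace
        - (ρAB * (MA ⊗ₖ (1 : Matrix (Fin dB) (Fin dB) ℂ))).trace
          * (ρAB * ((1 : Matrix (Fin dA) (Fin dA) ℂ) ⊗ₖ MB)).trace) :
    mutualInfo ρAB ≥ Cval ^ 2 / (2 * opNorm MA ^ 2 * opNorm MB ^ 2) := by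
  have hcov := norm_sq_covariance_le_mutualInfo hρ htr (MA ⊗ₖ MB) (norm_kronecker_le MA MB)
  rw [← Matrix.mul_kronecker_mul, Matrix.trace_kronecker, ← trace_mul_kronecker_one,
    ← trace_mul_one_kronecker, ← hC, Complex.norm_real, Real.norm_eq_abs, sq_abs] at hcov
  have hA : 0 < opNorm MA := (norm_nonneg _).lt_of_ne' hMAnorm
  have hB : 0 < opNorm MB := (norm_nonneg _).lt_of_ne' hMBnorm
  rw [ge_iff_le, div_le_iff₀ (by positivity)]
  calc Cval ^ 2 ≤ 2 * (opNorm MA * opNorm MB) ^ 2 * mutualInfo ρAB := hcov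
    _ = _ := by ring
end
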